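/- arXiv:2203.03533 — 2 statements merged into one kernel-verified Lean document; each statement's English description precedes it below -/
import Mathlib

section
/- The group X₀(19)(Q(√6)) of Q(√6)-rational points of the modular curve X₀(19) is cyclic of order 3; in particular it coincides with the group X₀(19)(Q) of rational points. -/
open Polynomial IntermediateField NumberField

/-- The modular curve `X₀(11)`: the elliptic curve `y² + y = x³ - x² - 10x - 20`
(Cremona label 11a1), with coefficients in the field `K`. -/
noncomputable def X0_11 (K : Type*) [Field K] : WeierstrassCurve.Affine K :=
  { a₁ := 0, a₂ := -1, a₃ := 1, a₄ := -10, a₆ := -20 }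

/-- The modular curve `X₀(17)`: the elliptic curve `y² + xy + y = x³ - x² - x - 14`
(Cremona label 17a1), with coefficients in the field `K`. -/
noncomputable def X0_17 (K : Type*) [Field K] : WeierstrassCurve.Affine K :=
  { a₁ := 1, a₂ := -1, a₃ := 1, a₄ := -1, a₆ := -14 }

/-- The modular curve `X₀(19)`: the elliptic curve `y² + y = x³ + x² - 9x - 15`
(Cremona label 19a3), with coefficients in the field `K`. -/
noncomputable def X0_19 (K : Type*) [Field K] : WeierstrassCurve.Affine K :=
  { a₁ := 0, a₂ := 1, a₃ := 1, a₄ := -9, a₆ := -15 }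

/-- Every `K`-point of the Weierstrass curve `W` has both coordinates in the image of `ℚ`,
i.e. `W(K)` coincides with the group of rational points `W(ℚ)`. -/
def PointsRational {K : Type*} [Field K] [CharZero K] (W : WeierstrassCurve.Affine K) : Prop :=
  ∀ x y : K, W.Nonsingular x y → (∃ a : ℚ, (a : K) = x) ∧ ∃ b : ℚ, (b : K) = y

namespace X19

open QuadraticAlgebra in
theorem quad_div (a b : ℤ)
    (hdiv : ∀ x y : ℚ, ∃ m n : ℤ,
      |(x - m) ^ 2 + b * (x - m) * (y - n) - a * (y - n) ^ 2| < 1)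
    (z g : QuadraticAlgebra ℤ a b) (hg : g.norm ≠ 0) :
    ∃ q, (z - q * g).norm.natAbs < g.norm.natAbs := by
  have hgQ : (g.norm : ℚ) ≠ 0 := by exact_mod_cast hg
  obtain ⟨m, n, h⟩ := hdiv (((z * star g).re : ℚ) / g.norm) (((z * star g).im : ℚ) / g.norm)
  refine ⟨⟨m, n⟩, ?_⟩
  have key : (((z - ⟨m, n⟩ * g).norm : ℤ) : ℚ) = g.norm *
      (((((z * star g).re : ℚ) / g.norm) - m) ^ 2 +
        b * ((((z * star g).re : ℚ) / g.norm) - m) * ((((z * star g).im : ℚ) / g.norm) - n) -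
        a * ((((z * star g).im : ℚ) / g.norm) - n) ^ 2) := by
    have h1 : ((z - ⟨m, n⟩ * g).norm) * g.norm =
        ((z * star g).re - m * g.norm) ^ 2 +
          b * ((z * star g).re - m * g.norm) * ((z * star g).im - n * g.norm) -
          a * ((z * star g).im - n * g.norm) ^ 2 := by
      simp only [norm_def, re_mul, im_mul, re_sub, im_sub, re_star, im_star]
      ring
    have h2 : (((z - ⟨m, n⟩ * g).norm : ℤ) : ℚ) * g.norm =
        ((z * star g).re - m * g.norm) ^ 2 +
          b * ((z * star g).re - m * g.norm) * ((z * star g).im - n * g.norm) -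
          a * ((z * star g).im - n * g.norm) ^ 2 := by exact_mod_cast h1
    field_simp
    linear_combination h2
  have h3 : |(((z - ⟨m, n⟩ * g).norm : ℤ) : ℚ)| < |(g.norm : ℚ)| := by
    rw [key, abs_mul]
    have : 0 < |(g.norm : ℚ)| := abs_pos.mpr hgQ
    nlinarith
  have h4 : |(z - ⟨m, n⟩ * g).norm| < |g.norm| := by exact_mod_cast h3
  rw [Int.abs_eq_natAbs, Int.abs_eq_natAbs] at h4
  exact_mod_cast h4

theorem quad_domain (a b : ℤ)
    (hN : ∀ z : QuadraticAlgebra ℤ a b, z.norm = 0 → z = 0) :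
    IsDomain (QuadraticAlgebra ℤ a b) := by
  have : NoZeroDivisors (QuadraticAlgebra ℤ a b) := ⟨by
    intro x y h
    have h1 : x.norm * y.norm = 0 := by rw [← map_mul, h]; simp
    rcases mul_eq_zero.mp h1 with h | h
    · exact Or.inl (hN _ h)
    · exact Or.inr (hN _ h)⟩
  exact NoZeroDivisors.to_isDomain _

theorem quad_pid (a b : ℤ)
    (hdiv : ∀ x y : ℚ, ∃ m n : ℤ,
      |(x - m) ^ 2 + b * (x - m) * (y - n) - a * (y - n) ^ 2| < 1)
    (hN : ∀ z : QuadraticAlgebra ℤ a b, z.norm = 0 → z = 0) :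
    IsPrincipalIdealRing (QuadraticAlgebra ℤ a b) := by
  refine ⟨fun I => ?_⟩
  by_cases hI : I = ⊥
  · subst hI; exact ⟨⟨0, by simp⟩⟩
  obtain ⟨x0, hx0, hx0'⟩ := Submodule.exists_mem_ne_zero_of_ne_bot hI
  let P : ℕ → Prop := fun k => ∃ x ∈ I, x ≠ 0 ∧ x.norm.natAbs = k
  have hP : ∃ k, P k := ⟨_, x0, hx0, hx0', rfl⟩
  classical
  obtain ⟨g, hgI, hg0, hgk⟩ := Nat.find_spec hP
  refine ⟨⟨g, ?_⟩⟩
  apply le_antisymm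
  · intro z hz
    obtain ⟨q, hq⟩ := quad_div a b hdiv z g (fun h => hg0 (hN _ h))
    rw [Submodule.mem_span_singleton]
    refine ⟨q, ?_⟩
    by_contra hne
    have hr : z - q * g ≠ 0 := fun h => hne (by rw [smul_eq_mul]; exact (sub_eq_zero.mp h).symm)
    have hrI : z - q * g ∈ I := I.sub_mem hz (I.mul_mem_left _ hgI)
    have := Nat.find_min' hP ⟨_, hrI, hr, rfl⟩
    omega
  · rw [Submodule.span_singleton_le_iff_mem]; exact hgI

theorem quad_cube (a b : ℤ)
    (hdiv : ∀ x y : ℚ, ∃ m n : ℤ,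
      |(x - m) ^ 2 + b * (x - m) * (y - n) - a * (y - n) ^ 2| < 1)
    (hN : ∀ z : QuadraticAlgebra ℤ a b, z.norm = 0 → z = 0)
    (α : QuadraticAlgebra ℤ a b) (c : ℤ) (hα : α.norm = c ^ 3)
    (hco : IsCoprime (2 * α.re + b * α.im) c) :
    ∃ u β : QuadraticAlgebra ℤ a b, (u.norm = 1 ∨ u.norm = -1) ∧ α = u * β ^ 3 := by
  have := quad_domain a b hN
  have := quad_pid a b hdiv hN
  have hmul : α * star α = (algebraMap ℤ (QuadraticAlgebra ℤ a b) c) ^ 3 := by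
    rw [← QuadraticAlgebra.algebraMap_norm_eq_mul_star, hα, map_pow]
  have hadd : α + star α = algebraMap ℤ (QuadraticAlgebra ℤ a b) (2 * α.re + b * α.im) := by
    rw [← QuadraticAlgebra.algebraMap_trace_eq_add_star]; rfl
  have hcop : IsCoprime α (star α) := by
    obtain ⟨u, v, huv⟩ := (hco.pow_right : IsCoprime (2 * α.re + b * α.im) (c ^ 3))
    refine ⟨algebraMap ℤ _ u + algebraMap ℤ _ v * star α, algebraMap ℤ _ u, ?_⟩
    have h1 : algebraMap ℤ (QuadraticAlgebra ℤ a b) (u * (2 * α.re + b * α.im) + v * c ^ 3) = 1 := by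
      rw [huv, map_one]
    rw [map_add, map_mul, map_mul, ← hadd, map_pow, ← hmul] at h1
    linear_combination h1
  obtain ⟨β, w, hw⟩ := exists_associated_pow_of_mul_eq_pow' hcop hmul
  refine ⟨w, β, ?_, by rw [← hw]; ring⟩
  have := QuadraticAlgebra.isUnit_iff_norm_isUnit.mp w.isUnit
  exact Int.isUnit_iff.mp this

/-- Eisenstein integers -/
theorem eis_div (x y : ℚ) : ∃ m n : ℤ,
    |(x - m) ^ 2 + ((-1 : ℤ) : ℚ) * (x - m) * (y - n) - ((-1 : ℤ) : ℚ) * (y - n) ^ 2| < 1 := by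
  refine ⟨round x, round y, ?_⟩
  have h1 := abs_sub_round x
  have h2 := abs_sub_round y
  rw [abs_le] at h1 h2
  generalize x - round x = s at *
  generalize y - round y = t at *
  push_cast
  rw [abs_lt]
  constructor <;> nlinarith [sq_nonneg (s - t), sq_nonneg (s + t)]

theorem eis_norm (z : QuadraticAlgebra ℤ (-1) (-1)) (h : z.norm = 0) : z = 0 := by
  rw [QuadraticAlgebra.norm_def] at h
  have h1 : z.im = 0 := by nlinarith [sq_nonneg (2 * z.re - z.im), sq_nonneg z.im]
  have h2 : z.re = 0 := by rw [h1] at h; nlinarith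
  ext <;> simp [h1, h2]

theorem m2_div (x y : ℚ) : ∃ m n : ℤ,
    |(x - m) ^ 2 + ((0 : ℤ) : ℚ) * (x - m) * (y - n) - ((-2 : ℤ) : ℚ) * (y - n) ^ 2| < 1 := by
  refine ⟨round x, round y, ?_⟩
  have h1 := abs_sub_round x
  have h2 := abs_sub_round y
  rw [abs_le] at h1 h2
  generalize x - round x = s at *
  generalize y - round y = t at *
  push_cast
  rw [abs_lt]
  constructor <;> nlinarith

theorem m2_norm (z : QuadraticAlgebra ℤ (-2) 0) (h : z.norm = 0) : z = 0 := by
  rw [QuadraticAlgebra.norm_def] at h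
  have h1 : z.im = 0 := by nlinarith [sq_nonneg (z.re), sq_nonneg z.im]
  have h2 : z.re = 0 := by rw [h1] at h; nlinarith
  ext <;> simp [h1, h2]

theorem no_sq_rat (k : ℤ) (hk : ¬ IsSquare k) (t : ℚ) : t ^ 2 ≠ k := by
  intro h
  apply hk
  have : IsSquare (k : ℚ) := ⟨t, by rw [← h]; ring⟩
  exact_mod_cast this

theorem not_sq_int (k m : ℤ) (h1 : m ^ 2 < k) (h2 : k < (m + 1) ^ 2) (hm : 0 ≤ m) : ¬ IsSquare k := by
  rintro ⟨r, hr⟩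
  have h3 : m < |r| := by
    apply lt_of_pow_lt_pow_left₀ 2 (abs_nonneg r); rw [sq_abs]; nlinarith
  have h4 : |r| < m + 1 := by
    apply lt_of_pow_lt_pow_left₀ 2 (by omega); rw [sq_abs]; nlinarith
  omega

theorem s6_div (x y : ℚ) : ∃ m n : ℤ,
    |(x - m) ^ 2 + ((0 : ℤ) : ℚ) * (x - m) * (y - n) - ((6 : ℤ) : ℚ) * (y - n) ^ 2| < 1 := by
  have h1 := abs_sub_round x
  have h2 := abs_sub_round y
  rw [abs_le] at h1 h2
  have key : ∀ t : ℚ, -(1/2) ≤ t → t ≤ 1/2 → 0 ≤ t → 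
     (|t ^ 2 - 6 * (y - round y) ^ 2| < 1 ∨ |(t + 1) ^ 2 - 6 * (y - round y) ^ 2| < 1) := by
    intro t ht1 ht2 ht3
    generalize y - round y = s at *
    by_cases hc : 6 * s ^ 2 < 1 + t ^ 2
    · left; rw [abs_lt]; constructor <;> nlinarith
    · right
      push Not at hc
      have hs : 6 * s ^ 2 ≤ 3 / 2 := by nlinarith
      rw [abs_lt]; constructor
      · nlinarith
      · by_contra hcon
        push Not at hcon
        have ht : t = 1 / 2 := by nlinarith
        subst ht
        have : s ^ 2 = 5 / 24 := by nlinarith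
        apply no_sq_rat 30 (not_sq_int 30 5 (by norm_num) (by norm_num) (by norm_num)) (12 * s)
        push_cast; nlinarith
  rcases le_total 0 (x - round x) with h0 | h0
  · rcases key (x - round x) (by linarith) (by linarith) h0 with h | h
    · exact ⟨round x, round y, by push_cast; convert h using 2; ring⟩
    · exact ⟨round x - 1, round y, by push_cast; convert h using 2; ring⟩
  · rcases key (-(x - round x)) (by linarith) (by linarith) (by linarith) with h | h
    · exact ⟨round x, round y, by push_cast; convert h using 2; ring⟩
    · exact ⟨round x + 1, round y, by push_cast; convert h using 2; ring⟩

theorem s6_norm (z : QuadraticAlgebra ℤ 6 0) (h : z.norm = 0) : z = 0 := by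
  rw [QuadraticAlgebra.norm_def] at h
  have h1 : z.im = 0 := by
    by_contra hne
    have hne' : (z.im : ℚ) ≠ 0 := by exact_mod_cast hne
    apply no_sq_rat 6 (not_sq_int 6 2 (by norm_num) (by norm_num) (by norm_num)) (z.re / z.im)
    have : (z.re : ℚ) * z.re + 0 * z.re * z.im - 6 * z.im * z.im = 0 := by exact_mod_cast h
    field_simp
    push_cast
    linear_combination this
  have h2 : z.re = 0 := by rw [h1] at h; nlinarith
  ext <;> simp [h1, h2]

/-- cube lemma over Z[√-2] in coordinates -/
theorem cube_m2 (x y c : ℤ) (h : x ^ 2 + 2 * y ^ 2 = c ^ 3) (hco : IsCoprime (2 * x) c) :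
    ∃ a b : ℤ, x = a ^ 3 - 6 * a * b ^ 2 ∧ y = 3 * a ^ 2 * b - 2 * b ^ 3 ∧ c = a ^ 2 + 2 * b ^ 2 := by
  obtain ⟨u, β, hu, he⟩ := quad_cube (-2) 0 m2_div m2_norm ⟨x, y⟩ c
    (by rw [QuadraticAlgebra.norm_def]; simp; linarith) (by simpa using hco)
  have hu1 : u = 1 ∨ u = -1 := by
    have h1 : u.re * u.re + 2 * u.im * u.im = 1 := by
      rw [QuadraticAlgebra.norm_def] at hu
      rcases hu with hu | hu <;> nlinarith [mul_self_nonneg u.re, mul_self_nonneg u.im]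
    have h2 : u.im = 0 := by
      by_contra hne
      have := Int.one_le_abs hne
      nlinarith [sq_abs u.im, mul_self_nonneg u.re]
    have h3 : u.re = 1 ∨ u.re = -1 := by
      rw [h2] at h1; exact mul_self_eq_one_iff.mp (by linarith)
    rcases h3 with h3 | h3
    · left; ext <;> simp [h2, h3, QuadraticAlgebra.re_one, QuadraticAlgebra.im_one]
    · right; ext <;> simp [h2, h3, QuadraticAlgebra.re_one, QuadraticAlgebra.im_one]
  have : ∃ γ : QuadraticAlgebra ℤ (-2) 0, (⟨x, y⟩ : QuadraticAlgebra ℤ (-2) 0) = γ ^ 3 := by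
    rcases hu1 with rfl | rfl
    · exact ⟨β, by rw [he]; ring⟩
    · exact ⟨-β, by rw [he]; ring⟩
  obtain ⟨γ, hγ⟩ := this
  have e1 := congrArg QuadraticAlgebra.re hγ
  have e2 := congrArg QuadraticAlgebra.im hγ
  simp [pow_succ] at e1 e2
  refine ⟨γ.re, γ.im, by rw [e1]; ring, by rw [e2]; ring, ?_⟩
  have : c ^ 3 = (γ.re ^ 2 + 2 * γ.im ^ 2) ^ 3 := by rw [← h, e1, e2]; ring
  exact (Odd.strictMono_pow (by decide : Odd 3)).injective this


theorem cube_eis (p q c : ℤ) (h : p ^ 2 - 3 * p * q + 9 * q ^ 2 = c ^ 3)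
    (hco : IsCoprime (2 * p - 3 * q) c) (h3 : ¬ (3 : ℤ) ∣ c) :
    ∃ x y : ℤ, p = x ^ 3 + y ^ 3 - 3 * x * y ^ 2 ∧ q = x * y * (x - y) ∧
      c = x ^ 2 - x * y + y ^ 2 := by
  obtain ⟨u, β, hu, he⟩ := quad_cube (-1) (-1) eis_div eis_norm ⟨p, 3 * q⟩ c
    (by rw [QuadraticAlgebra.norm_def]; simp; linarith)
    (by simp only [neg_mul, one_mul, ← sub_eq_add_neg]; exact hco)
  have hp3 : ¬ (3 : ℤ) ∣ p := by
    intro hp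
    apply h3
    apply Int.prime_three.dvd_of_dvd_pow (n := 3)
    rw [← h]
    obtain ⟨k, rfl⟩ := hp
    exact ⟨3 * k ^ 2 - 3 * k * q + 3 * q ^ 2, by ring⟩
  have e1 := congrArg QuadraticAlgebra.re he
  have e2 := congrArg QuadraticAlgebra.im he
  simp [pow_succ] at e1 e2
  have h1 : u.re * u.re - u.re * u.im + u.im * u.im = 1 := by
    rw [QuadraticAlgebra.norm_def] at hu
    rcases hu with hu | hu <;>
      nlinarith [sq_nonneg (u.re - u.im), mul_self_nonneg u.re, mul_self_nonneg u.im]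
  have b1 : u.re ≤ 1 := by nlinarith [sq_nonneg (u.re - 2 * u.im)]
  have b2 : -1 ≤ u.re := by nlinarith [sq_nonneg (u.re - 2 * u.im)]
  have b3 : u.im ≤ 1 := by nlinarith [sq_nonneg (u.im - 2 * u.re)]
  have b4 : -1 ≤ u.im := by nlinarith [sq_nonneg (u.im - 2 * u.re)]
  generalize u.re = r at *
  generalize u.im = s at *
  generalize β.re = x at *
  generalize β.im = y at *
  have main : ∃ x y : ℤ, p = x ^ 3 + y ^ 3 - 3 * x * y ^ 2 ∧ q = x * y * (x - y) := by
    interval_cases r <;> interval_cases s <;> norm_num at h1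
    · exact absurd ⟨q + x * y * (x - y), by linarith⟩ hp3
    · exact ⟨-x, -y, by linarith, by linarith⟩
    · exact absurd ⟨x * y * (x - y), by linarith⟩ hp3
    · exact absurd ⟨- (x * y * (x - y)), by linarith⟩ hp3
    · exact ⟨x, y, by linarith, by linarith⟩
    · exact absurd ⟨q + x * y * (y - x), by linarith⟩ hp3
  obtain ⟨x, y, hx, hy⟩ := main
  refine ⟨x, y, hx, hy, ?_⟩
  have : c ^ 3 = (x ^ 2 - x * y + y ^ 2) ^ 3 := by rw [← h, hx, hy]; ring
  exact (Odd.strictMono_pow (by decide : Odd 3)).injective this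

theorem fund6 : Pell.IsFundamental (Pell.Solution₁.mk (d := 6) 5 2 (by norm_num)) := by
  refine ⟨by simp, by simp, ?_⟩
  intro b hb
  simp only [Pell.Solution₁.x_mk]
  by_contra hlt
  push Not at hlt
  have hp := b.prop
  generalize b.x = x at *
  generalize b.y = y at *
  have : (x ^ 2 - 6 * y ^ 2) % 6 = 1 := by rw [hp]; norm_num
  interval_cases x <;> omega

theorem cube_s6 (x y c : ℤ) (h : x ^ 2 - 6 * y ^ 2 = c ^ 3) (hco : IsCoprime (2 * x) c) :
    ∃ a b P Q : ℤ, P = a ^ 3 + 18 * a * b ^ 2 ∧ Q = 3 * a ^ 2 * b + 6 * b ^ 3 ∧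
      c = a ^ 2 - 6 * b ^ 2 ∧
      ((x = P ∧ y = Q) ∨ (x = 5 * P + 12 * Q ∧ y = 2 * P + 5 * Q) ∨
        (x = 5 * P - 12 * Q ∧ y = 5 * Q - 2 * P)) := by
  obtain ⟨u, β, hu, he⟩ := quad_cube 6 0 s6_div s6_norm ⟨x, y⟩ c
    (by rw [QuadraticAlgebra.norm_def]; simp; linarith) (by simpa using hco)
  have hu1 : u.re ^ 2 - 6 * u.im ^ 2 = 1 := by
    rw [QuadraticAlgebra.norm_def] at hu
    rcases hu with hu | hu
    · linarith
    · exfalso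
      have : (u.re * u.re) % 3 = 2 := by
        have : u.re * u.re = 3 * (2 * u.im * u.im) - 1 := by linarith
        omega
      have h3 : u.re % 3 = 0 ∨ u.re % 3 = 1 ∨ u.re % 3 = 2 := by omega
      rw [Int.mul_emod] at this
      rcases h3 with h3 | h3 | h3 <;> rw [h3] at this <;> norm_num at this
  obtain ⟨n, hn⟩ := fund6.eq_zpow_or_neg_zpow (Pell.Solution₁.mk (d := 6) u.re u.im hu1)
  set ε := Pell.Solution₁.mk (d := 6) 5 2 (by norm_num) with hε
  have hn3 : ∃ k : ℤ, ∃ δ : Pell.Solution₁ 6, (δ = 1 ∨ δ = ε ∨ δ = ε⁻¹) ∧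
      ε ^ n = (ε ^ k) ^ 3 * δ := by
    have : ∃ k : ℤ, n = k * 3 ∨ n = k * 3 + 1 ∨ n = k * 3 + (-1) := ⟨(n + 1) / 3, by omega⟩
    obtain ⟨k, hk | hk | hk⟩ := this
    · exact ⟨k, 1, by simp, by rw [hk, zpow_mul]; simp⟩
    · exact ⟨k, ε, by simp, by rw [hk, zpow_add, zpow_mul]; simp⟩
    · exact ⟨k, ε⁻¹, by simp, by rw [hk, zpow_add, zpow_mul]; simp⟩
  obtain ⟨k, δ, hδ, hk⟩ := hn3
  have hsgn : ∃ t : Pell.Solution₁ 6, Pell.Solution₁.mk (d := 6) u.re u.im hu1 = t * t * t * δ := by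
    rcases hn with hn | hn
    · exact ⟨ε ^ k, by rw [hn, hk]; simp only [pow_succ, pow_zero, one_mul]⟩
    · exact ⟨- ε ^ k, by rw [hn, hk]; simp only [pow_succ, pow_zero, one_mul]; simp⟩
  obtain ⟨t, ht⟩ := hsgn
  have ex := congrArg Pell.Solution₁.x ht
  have ey := congrArg Pell.Solution₁.y ht
  simp only [Pell.Solution₁.x_mul, Pell.Solution₁.y_mul, Pell.Solution₁.x_mk,
    Pell.Solution₁.y_mk] at ex ey
  have hδx : (δ.x = 1 ∧ δ.y = 0) ∨ (δ.x = 5 ∧ δ.y = 2) ∨ (δ.x = 5 ∧ δ.y = -2) := by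
    rcases hδ with rfl | rfl | rfl <;> simp [hε]
  have e1 := congrArg QuadraticAlgebra.re he
  have e2 := congrArg QuadraticAlgebra.im he
  simp [pow_succ] at e1 e2
  rw [ex, ey] at e1 e2
  refine ⟨t.x * β.re + 6 * (t.y * β.im), t.x * β.im + t.y * β.re, _, _, rfl, rfl, ?_⟩
  have main : ∀ a b : ℤ, a = t.x * β.re + 6 * (t.y * β.im) → b = t.x * β.im + t.y * β.re →
      (x = (a ^ 3 + 18 * a * b ^ 2) ∧ y = 3 * a ^ 2 * b + 6 * b ^ 3) ∨
      (x = 5 * (a ^ 3 + 18 * a * b ^ 2) + 12 * (3 * a ^ 2 * b + 6 * b ^ 3) ∧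
        y = 2 * (a ^ 3 + 18 * a * b ^ 2) + 5 * (3 * a ^ 2 * b + 6 * b ^ 3)) ∨
      (x = 5 * (a ^ 3 + 18 * a * b ^ 2) - 12 * (3 * a ^ 2 * b + 6 * b ^ 3) ∧
        y = 5 * (3 * a ^ 2 * b + 6 * b ^ 3) - 2 * (a ^ 3 + 18 * a * b ^ 2)) := by
    intro a b ha hb
    rcases hδx with ⟨h1, h2⟩ | ⟨h1, h2⟩ | ⟨h1, h2⟩ <;> rw [h1, h2] at e1 e2
    · left; rw [e1, e2, ha, hb]; constructor <;> ring
    · right; left; rw [e1, e2, ha, hb]; constructor <;> ring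
    · right; right; rw [e1, e2, ha, hb]; constructor <;> ring
  have m := main _ _ rfl rfl
  refine ⟨?_, m⟩
  generalize t.x * β.re + 6 * (t.y * β.im) = a at m
  generalize t.x * β.im + t.y * β.re = b at m
  have : c ^ 3 = (a ^ 2 - 6 * b ^ 2) ^ 3 := by
    rw [← h]
    rcases m with ⟨h1, h2⟩ | ⟨h1, h2⟩ | ⟨h1, h2⟩ <;> rw [h1, h2] <;> ring
  exact (Odd.strictMono_pow (by decide : Odd 3)).injective this

end X19
namespace X19

theorem cop_of_prime (u v : ℤ) (h : ∀ p : ℤ, Prime p → p ∣ u → p ∣ v → False) : IsCoprime u v := by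
  apply isCoprime_of_prime_dvd
  · rintro ⟨rfl, rfl⟩
    exact h 2 Int.prime_two (dvd_zero _) (dvd_zero _)
  · exact fun z hz h1 h2 => h z hz h1 h2

theorem cop_prime {u v p : ℤ} (h : IsCoprime u v) (hp : Prime p) (h1 : p ∣ u) (h2 : p ∣ v) : False :=
  hp.not_isUnit (h.isUnit_of_dvd' h1 h2)

theorem p19 : Prime (19 : ℤ) := by norm_num
theorem p3 : Prime (3 : ℤ) := by norm_num

theorem prime_dvd_symm {p q : ℤ} (hp : Prime p) (hq : Prime q) (h : p ∣ q) : q ∣ p :=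
  (hp.irreducible.dvd_symm hq.irreducible h)

theorem cube_inj {a b : ℤ} (h : a ^ 3 = b ^ 3) : a = b :=
  (Odd.strictMono_pow (by decide : Odd 3)).injective h

theorem cubes {a b c : ℤ} (hc : IsCoprime a b) (h : a * b = c ^ 3) :
    ∃ u v : ℤ, a = u ^ 3 ∧ b = v ^ 3 ∧ c = u * v := by
  obtain ⟨⟨u, hu⟩, v, hv⟩ := Int.eq_pow_of_mul_eq_pow_odd hc (by decide : Odd 3) h
  exact ⟨u, v, hu, hv, cube_inj (by rw [← h, hu, hv]; ring)⟩

/-- a prime whose square divides `19 l ^ 3` divides `l` -/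
theorem sq_dvd_19 {p l : ℤ} (hp : Prime p) (h : p * p ∣ 19 * l ^ 3) : p ∣ l := by
  have h1 : p ∣ 19 * l ^ 3 := (Dvd.intro _ rfl).trans h
  rcases hp.dvd_or_dvd h1 with h2 | h2
  · obtain ⟨k, hk⟩ := h2
    have hk2 : ¬ p ∣ k := by
      intro hpk
      have h4 : p * p ∣ 19 := by rw [hk]; exact mul_dvd_mul_left p hpk
      have h5 := prime_dvd_symm hp p19 (Dvd.intro _ hk.symm)
      have h6 : (19 * 19 : ℤ) ∣ 19 := (mul_dvd_mul h5 h5).trans h4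
      norm_num at h6
    rw [hk, mul_assoc] at h
    have h7 : p ∣ k * l ^ 3 := (mul_dvd_mul_iff_left hp.ne_zero).mp h
    exact hp.dvd_of_dvd_pow ((hp.dvd_or_dvd h7).resolve_left hk2)
  · exact hp.dvd_of_dvd_pow h2

theorem three_aux {Q1 Q2 Q3 l : ℤ} (h12 : IsCoprime Q1 Q2) (h13 : IsCoprime Q1 Q3)
    (h23 : IsCoprime Q2 Q3) (h : Q1 * Q2 * Q3 = 19 * l ^ 3) (hd : (19 : ℤ) ∣ Q1) :
    ∃ X Y Z : ℤ, l = X * Y * Z ∧ Q1 = 19 * X ^ 3 ∧ Q2 = Y ^ 3 ∧ Q3 = Z ^ 3 := by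
  obtain ⟨R, rfl⟩ := hd
  have h1 : R * (Q2 * Q3) = l ^ 3 := by
    apply mul_left_cancel₀ (by norm_num : (19 : ℤ) ≠ 0); linarith
  have c1 : IsCoprime R (Q2 * Q3) := (h12.of_mul_left_right).mul_right (h13.of_mul_left_right)
  obtain ⟨u, v, hu, hv, hl⟩ := cubes c1 h1
  obtain ⟨Y, Z, hY, hZ, hv'⟩ := cubes h23 hv
  exact ⟨u, Y, Z, by rw [hl, hv']; ring, by rw [hu], hY, hZ⟩

theorem three {Q1 Q2 Q3 l : ℤ} (h12 : IsCoprime Q1 Q2) (h13 : IsCoprime Q1 Q3)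
    (h23 : IsCoprime Q2 Q3) (h : Q1 * Q2 * Q3 = 19 * l ^ 3) :
    ∃ X Y Z : ℤ, l = X * Y * Z ∧ ((Q1 = 19 * X ^ 3 ∧ Q2 = Y ^ 3 ∧ Q3 = Z ^ 3) ∨
      (Q2 = 19 * X ^ 3 ∧ Q1 = Y ^ 3 ∧ Q3 = Z ^ 3) ∨
      (Q3 = 19 * X ^ 3 ∧ Q1 = Y ^ 3 ∧ Q2 = Z ^ 3)) := by
  have hd : (19 : ℤ) ∣ Q1 * Q2 * Q3 := Dvd.intro _ h.symm
  rcases p19.dvd_or_dvd hd with h1 | h3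
  · rcases p19.dvd_or_dvd h1 with h1 | h2
    · obtain ⟨X, Y, Z, a, b⟩ := three_aux h12 h13 h23 h h1
      exact ⟨X, Y, Z, a, Or.inl b⟩
    · obtain ⟨X, Y, Z, a, b⟩ := three_aux h12.symm h23 h13 (by rw [← h]; ring) h2
      exact ⟨X, Y, Z, a, Or.inr (Or.inl b)⟩
  · obtain ⟨X, Y, Z, a, b⟩ := three_aux h13.symm h23.symm h12 (by rw [← h]; ring) h3
    exact ⟨X, Y, Z, a, Or.inr (Or.inr b)⟩

theorem cop_cube {a b : ℤ} (h : IsCoprime (a ^ 3) (b ^ 3)) : IsCoprime a b :=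
  (IsCoprime.pow_iff (by norm_num) (by norm_num)).mp h

/-- the second half of the `3 ∣ C` case -/
theorem caseA_aux {F1 F2 F3 l : ℤ} (h : F1 * F2 * F3 = 513 * l ^ 3) (hs : F1 + F2 + F3 = 24 * l)
    (h1 : (3 : ℤ) ∣ F1) (h2 : ¬ (3 : ℤ) ∣ F2) (h3 : ¬ (3 : ℤ) ∣ F3)
    (hp : ∀ p : ℤ, Prime p → p ∣ l → (p ∣ F1 ∧ p ∣ F2 ∨ p ∣ F1 ∧ p ∣ F3 ∨ p ∣ F2 ∧ p ∣ F3) → False) :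
    ∃ A B C : ℤ, A ^ 3 + B ^ 3 + 8 * A * B * C = 19 * C ^ 3 ∧ IsCoprime A B ∧ C ∣ 3 * l ∧
      (C = 0 → l = 0) := by
  have c27 : IsCoprime (27 : ℤ) (F2 * F3) := by
    apply cop_of_prime
    intro p hpp hp1 hp2
    have hp3 : p ∣ 3 := by
      have : p ∣ 3 ^ 3 := by norm_num; exact hp1
      exact hpp.dvd_of_dvd_pow this
    have h3p := prime_dvd_symm hpp p3 hp3
    rcases p3.dvd_or_dvd (h3p.trans hp2) with h | h
    · exact h2 h
    · exact h3 h
  have hd : (27 : ℤ) ∣ F1 := by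
    apply c27.dvd_of_dvd_mul_right
    exact ⟨19 * l ^ 3, by linarith⟩
  obtain ⟨Q, rfl⟩ := hd
  have hQ : Q * F2 * F3 = 19 * l ^ 3 := by linarith
  have c1 : IsCoprime Q F2 := by
    apply cop_of_prime
    intro p hpp a b
    refine hp p hpp (sq_dvd_19 hpp ?_) (Or.inl ⟨a.mul_left _, b⟩)
    rw [← hQ]; exact (mul_dvd_mul a b).mul_right _
  have c2 : IsCoprime Q F3 := by
    apply cop_of_prime
    intro p hpp a b
    refine hp p hpp (sq_dvd_19 hpp ?_) (Or.inr (Or.inl ⟨a.mul_left _, b⟩))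
    rw [← hQ]; exact mul_dvd_mul (a.mul_right _) b
  have c3 : IsCoprime F2 F3 := by
    apply cop_of_prime
    intro p hpp a b
    refine hp p hpp (sq_dvd_19 hpp ?_) (Or.inr (Or.inr ⟨a, b⟩))
    rw [← hQ]; exact mul_dvd_mul (a.mul_left _) b
  have cz : ∀ Y Z F : ℤ, ¬ (3 : ℤ) ∣ F → F = Z ^ 3 → IsCoprime (Y ^ 3) (Z ^ 3) →
      IsCoprime (3 * Y) Z := by
    intro Y Z F hF hFZ hc
    refine IsCoprime.mul_left ?_ (cop_cube hc)
    apply (p3.irreducible.coprime_iff_not_dvd).mpr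
    intro hz
    exact hF (by rw [hFZ]; exact dvd_pow hz (by norm_num))
  obtain ⟨X, Y, Z, hl, h⟩ := three c1 c2 c3 hQ
  rcases h with ⟨e1, e2, e3⟩ | ⟨e1, e2, e3⟩ | ⟨e1, e2, e3⟩
  · refine ⟨Y, Z, -3 * X, ?_, ?_, ?_, ?_⟩
    · rw [e1, e2, e3, hl] at hs; linarith
    · rw [e2, e3] at c3; exact cop_cube c3
    · rw [hl]; exact ⟨-Y * Z, by ring⟩
    · intro h0
      have : X = 0 := by linarith
      rw [hl, this]; ring
  · refine ⟨3 * Y, Z, -X, ?_, ?_, ?_, ?_⟩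
    · rw [e1, e2, e3, hl] at hs; linarith
    · rw [e2, e3] at c2; exact cz _ _ _ h3 e3 c2
    · rw [hl]; exact ⟨-3 * Y * Z, by ring⟩
    · intro h0
      have : X = 0 := by linarith
      rw [hl, this]; ring
  · refine ⟨3 * Y, Z, -X, ?_, ?_, ?_, ?_⟩
    · rw [e1, e2, e3, hl] at hs; linarith
    · rw [e2, e3] at c1; exact cz _ _ _ h2 e3 c1
    · rw [hl]; exact ⟨-3 * Y * Z, by ring⟩
    · intro h0
      have : X = 0 := by linarith
      rw [hl, this]; ring

/-- descent step when `3 ∤ C` -/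
theorem stepA1 {A B C : ℤ} (h : A ^ 3 + B ^ 3 + 8 * A * B * C = 19 * C ^ 3) (hc : IsCoprime A B)
    (hC : C ≠ 0) (h3 : ¬ (3 : ℤ) ∣ C) :
    ∃ A' B' C' : ℤ, A' ^ 3 + B' ^ 3 + 8 * A' * B' * C' = 19 * C' ^ 3 ∧ IsCoprime A' B' ∧
      C'.natAbs < C.natAbs ∧ C' ≠ 0 := by
  have hLN : (3 * A + 3 * B - 8 * C) *
      ((8 * C + 3 * B) ^ 2 - 3 * (8 * C + 3 * B) * (B - A) + 9 * (B - A) ^ 2) = C ^ 3 := by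
    linear_combination 27 * h
  have cLN : IsCoprime (3 * A + 3 * B - 8 * C)
      ((8 * C + 3 * B) ^ 2 - 3 * (8 * C + 3 * B) * (B - A) + 9 * (B - A) ^ 2) := by
    apply cop_of_prime
    intro p hp h1 h2
    have pC : p ∣ C := by
      apply hp.dvd_of_dvd_pow (n := 3); rw [← hLN]; exact h1.mul_right _
    have np3 : ¬ p ∣ 3 := fun hh => h3 ((prime_dvd_symm hp p3 hh).trans pC)
    have s1 : p ∣ A + B := by
      have : p ∣ 3 * (A + B) := by
        have e : 3 * (A + B) = (3 * A + 3 * B - 8 * C) + C * 8 := by ring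
        rw [e]; exact h1.add (pC.mul_right _)
      exact (hp.dvd_or_dvd this).resolve_left np3
    have s2 : p ∣ 3 ^ 3 * (A * B) := by
      have e : 3 ^ 3 * (A * B) = (A + B) * (9 * (A + B)) -
        ((8 * C + 3 * B) ^ 2 - 3 * (8 * C + 3 * B) * (B - A) + 9 * (B - A) ^ 2) +
        C * (64 * C + 24 * B + 24 * A) := by ring
      rw [e]
      exact (((s1.mul_right _).sub h2).add (pC.mul_right _))
    rcases hp.dvd_or_dvd s2 with s | s
    · exact np3 (hp.dvd_of_dvd_pow s)
    rcases hp.dvd_or_dvd s with s | s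
    · exact cop_prime hc hp s ((dvd_add_right s).mp s1)
    · exact cop_prime hc hp ((dvd_add_left s).mp s1) s
  obtain ⟨l, f, hL, hN, hlf⟩ := cubes cLN hLN
  have clf : IsCoprime l f := by rw [hL, hN] at cLN; exact cop_cube cLN
  have f3 : ¬ (3 : ℤ) ∣ f := fun hh => h3 (by rw [hlf]; exact hh.mul_left _)
  have ctr : IsCoprime (2 * (8 * C + 3 * B) - 3 * (B - A)) f := by
    have e : 2 * (8 * C + 3 * B) - 3 * (B - A) = l ^ 3 + f * (24 * l) := by
      linear_combination hL + 24 * hlf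
    rw [e]
    exact IsCoprime.add_mul_left_left clf.pow_left _
  obtain ⟨x, y, e1, e2, e3⟩ := cube_eis _ _ _ hN ctr f3
  have key : (2 * x - y + 8 * l) * (-x - y + 8 * l) * (2 * y - x + 8 * l) = 513 * l ^ 3 := by
    rw [e3] at hlf
    linear_combination hL - 2 * e1 + 3 * e2 + 24 * hlf
  have d3 : (3 : ℤ) ∣ (-x - y + 8 * l) := by
    have : (3 : ℤ) ∣ (2 * x - y + 8 * l) * (-x - y + 8 * l) * (2 * y - x + 8 * l) := by
      rw [key]; exact ⟨171 * l ^ 3, by ring⟩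
    rcases p3.dvd_or_dvd this with h | h
    · rcases p3.dvd_or_dvd h with h | h <;> omega
    · omega
  obtain ⟨Q, hQ⟩ := d3
  have k2 : (Q + x) * Q * (Q + y) = 19 * l ^ 3 := by
    have a1 : 2 * x - y + 8 * l = 3 * (Q + x) := by linarith
    have a2 : 2 * y - x + 8 * l = 3 * (Q + y) := by linarith
    rw [a1, a2, hQ] at key
    linarith
  have hsum : x + y + 3 * Q = 8 * l := by linarith
  have bad : ∀ p : ℤ, Prime p → p ∣ l → p ∣ x → p ∣ y → False := by
    intro p hp a b c
    refine cop_prime clf hp a ?_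
    rw [e3]
    have : x ^ 2 - x * y + y ^ 2 = x * (x - y) + y * y := by ring
    rw [this]; exact (b.mul_right _).add (c.mul_right _)
  have c12 : IsCoprime (Q + x) Q := by
    apply cop_of_prime
    intro p hp a b
    have pl : p ∣ l := sq_dvd_19 hp (by rw [← k2]; exact (mul_dvd_mul a b).mul_right _)
    have px : p ∣ x := (dvd_add_right b).mp a
    have py : p ∣ y := by
      have : y = l * 8 - x - Q * 3 := by linarith
      rw [this]; exact ((pl.mul_right _).sub px).sub (b.mul_right _)
    exact bad p hp pl px py
  have c23 : IsCoprime Q (Q + y) := by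
    apply cop_of_prime
    intro p hp a b
    have pl : p ∣ l := sq_dvd_19 hp (by rw [← k2]; exact mul_dvd_mul (a.mul_left _) b)
    have py : p ∣ y := (dvd_add_right a).mp b
    have px : p ∣ x := by
      have : x = l * 8 - y - Q * 3 := by linarith
      rw [this]; exact ((pl.mul_right _).sub py).sub (a.mul_right _)
    exact bad p hp pl px py
  have c13 : IsCoprime (Q + x) (Q + y) := by
    apply cop_of_prime
    intro p hp a b
    have pl : p ∣ l := sq_dvd_19 hp (by rw [← k2]; exact mul_dvd_mul (a.mul_right _) b)
    have pQ : p ∣ Q := by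
      have : Q = l * 8 - (Q + x) - (Q + y) := by linarith
      rw [this]; exact ((pl.mul_right _).sub a).sub b
    exact bad p hp pl ((dvd_add_right pQ).mp a) ((dvd_add_right pQ).mp b)
  have l0 : l ≠ 0 := by rintro rfl; apply hC; rw [hlf]; ring
  have f0 : f ≠ 0 := by rintro rfl; apply hC; rw [hlf]; ring
  have f1 : 2 ≤ f := by
    have : 0 ≤ f := by rw [e3]; nlinarith [sq_nonneg (x - y), sq_nonneg x, sq_nonneg y]
    have : f ≠ 1 := by
      intro hf
      rw [hf] at hN
      have q0 : B - A = 0 := by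
        by_contra hne
        have := Int.one_le_abs hne
        nlinarith [sq_abs (B - A), sq_nonneg (2 * (8 * C + 3 * B) - 3 * (B - A))]
      have hAB : B = A := by linarith
      subst hAB
      have hu : IsUnit B := hc.isUnit_of_dvd' dvd_rfl dvd_rfl
      have hCd : C ∣ 2 := by
        rcases Int.isUnit_iff.mp hu with h1 | h1 <;> rw [h1] at h
        · exact ⟨19 * C ^ 2 - 8, by linarith⟩
        · exact ⟨-(19 * C ^ 2 - 8), by linarith⟩
      have b1 := Int.le_of_dvd (by norm_num) hCd
      have b2 := Int.le_of_dvd (by norm_num) (Int.neg_dvd.mpr hCd)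
      have b3 : -2 ≤ C := by linarith
      rcases Int.isUnit_iff.mp hu with h1 | h1 <;> rw [h1] at h <;>
        interval_cases C <;> norm_num at h
    omega
  have fin : ∀ X Y Z : ℤ, l = X * Y * Z → (-X).natAbs < C.natAbs ∧ -X ≠ 0 := by
    intro X Y Z hl
    have hX : X ∣ l := ⟨Y * Z, by rw [hl]; ring⟩
    have h1 : X.natAbs ≤ l.natAbs := Nat.le_of_dvd (Int.natAbs_pos.mpr l0) (Int.natAbs_dvd_natAbs.mpr hX)
    have h2 : C.natAbs = l.natAbs * f.natAbs := by rw [hlf, Int.natAbs_mul]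
    have h3 : 2 ≤ f.natAbs := by omega
    have h4 : 0 < l.natAbs := Int.natAbs_pos.mpr l0
    constructor
    · rw [Int.natAbs_neg, h2]; nlinarith
    · intro h0; apply l0; rw [hl]; have : X = 0 := by linarith
      rw [this]; ring
  obtain ⟨X, Y, Z, hl, h⟩ := three c12 c13 c23 k2
  obtain ⟨g1, g2⟩ := fin X Y Z hl
  rcases h with ⟨e1, e2, e3⟩ | ⟨e1, e2, e3⟩ | ⟨e1, e2, e3⟩
  · exact ⟨Y, Z, -X, by rw [hl] at hsum; linarith, by rw [e3, e2] at c23; exact cop_cube c23, g1, g2⟩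
  · exact ⟨Y, Z, -X, by rw [hl] at hsum; linarith, by rw [e2, e3] at c13; exact cop_cube c13, g1, g2⟩
  · exact ⟨Y, Z, -X, by rw [hl] at hsum; linarith, by rw [e2, e3] at c12; exact cop_cube c12, g1, g2⟩

/-- descent step when `3 ∣ C` -/
theorem stepA2 {A B C : ℤ} (h : A ^ 3 + B ^ 3 + 8 * A * B * C = 19 * C ^ 3) (hc : IsCoprime A B)
    (hC : C ≠ 0) (h3 : (3 : ℤ) ∣ C) :
    ∃ A' B' C' : ℤ, A' ^ 3 + B' ^ 3 + 8 * A' * B' * C' = 19 * C' ^ 3 ∧ IsCoprime A' B' ∧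
      C'.natAbs < C.natAbs ∧ C' ≠ 0 := by
  obtain ⟨C1, rfl⟩ := h3
  have hAB : (3 : ℤ) ∣ A + B := by
    apply p3.dvd_of_dvd_pow (n := 3)
    exact ⟨A * B * (A + B) - 8 * A * B * C1 + 19 * 9 * C1 ^ 3, by linear_combination h⟩
  have hA : ¬ (3 : ℤ) ∣ A := fun hh => cop_prime hc p3 hh ((dvd_add_right hh).mp hAB)
  have hB : ¬ (3 : ℤ) ∣ B := fun hh => cop_prime hc p3 ((dvd_add_left hh).mp hAB) hh
  obtain ⟨t, ht⟩ := hAB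
  obtain rfl : A = 3 * t - B := by linarith
  have hC1 : (3 : ℤ) ∣ C1 := by
    have : (3 : ℤ) ∣ 8 * ((3 * t - B) * B * C1) :=
      ⟨19 * 3 * C1 ^ 3 - 3 * t ^ 3 + t * (3 * t - B) * B, by linarith⟩
    have : (3 : ℤ) ∣ (3 * t - B) * B * C1 := by omega
    rcases p3.dvd_or_dvd this with h | h
    · rcases p3.dvd_or_dvd h with h | h
      · exact absurd h hA
      · exact absurd h hB
    · exact h
  obtain ⟨D, rfl⟩ := hC1
  have hh : (t - 8 * D) * (3 * (t ^ 2 + 8 * t * D + 64 * D ^ 2) - (3 * t - B) * B) = 3 * D ^ 3 := by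
    linarith
  have hN3 : ¬ (3 : ℤ) ∣ (3 * (t ^ 2 + 8 * t * D + 64 * D ^ 2) - (3 * t - B) * B) := by
    intro hd
    have : (3 : ℤ) ∣ (3 * t - B) * B := by omega
    rcases p3.dvd_or_dvd this with h | h
    · exact absurd h hA
    · exact absurd h hB
  have h3h : (3 : ℤ) ∣ t - 8 * D :=
    (p3.dvd_or_dvd (⟨D ^ 3, hh⟩ : (3 : ℤ) ∣ _)).resolve_right hN3
  obtain ⟨k, hk⟩ := h3h
  obtain rfl : t = 8 * D + 3 * k := by linarith
  set p := B - 24 * D - 6 * k with hpdef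
  set q := -(8 * D + k) with hqdef
  have hN : (3 * ((8 * D + 3 * k) ^ 2 + 8 * (8 * D + 3 * k) * D + 64 * D ^ 2) -
      (3 * (8 * D + 3 * k) - B) * B) = p ^ 2 - 3 * p * q + 9 * q ^ 2 := by
    rw [hpdef, hqdef]; ring
  rw [hN] at hN3
  have hkN : k * (p ^ 2 - 3 * p * q + 9 * q ^ 2) = D ^ 3 := by
    rw [← hN]; linarith
  have ckN : IsCoprime k (p ^ 2 - 3 * p * q + 9 * q ^ 2) := by
    apply cop_of_prime
    intro π hp h1 h2
    have pD : π ∣ D := by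
      apply hp.dvd_of_dvd_pow (n := 3); rw [← hkN]; exact h1.mul_right _
    have s1 : π ∣ B * B := by
      have e : B * B = (p ^ 2 - 3 * p * q + 9 * q ^ 2) -
        k * (27 * k + 216 * D - 9 * B) - D * (576 * D - 24 * B) := by rw [← hN]; ring
      rw [e]; exact (h2.sub (h1.mul_right _)).sub (pD.mul_right _)
    have s2 : π ∣ B := by rcases hp.dvd_or_dvd s1 with h | h <;> exact h
    refine cop_prime hc hp ?_ s2
    have e : 3 * (8 * D + 3 * k) - B = D * 24 + k * 9 - B := by ring
    rw [e]; exact ((pD.mul_right _).add (h1.mul_right _)).sub s2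
  obtain ⟨l, f, hl, hf, hlf⟩ := cubes ckN hkN
  have clf : IsCoprime l f := by rw [hl, hf] at ckN; exact cop_cube ckN
  have f3 : ¬ (3 : ℤ) ∣ f := fun h => hN3 (by rw [hf]; exact dvd_pow h (by norm_num))
  have ctr : IsCoprime (2 * p - 3 * q) f := by
    apply cop_of_prime
    intro π hp h1 h2
    have np3 : ¬ π ∣ 3 := fun h => f3 ((prime_dvd_symm hp p3 h).trans h2)
    have s : π ∣ 3 ^ 3 * (q * q) := by
      have e : 3 ^ 3 * (q * q) = f * (4 * f ^ 2) - (2 * p - 3 * q) * (2 * p - 3 * q) := by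
        linear_combination 4 * hf
      rw [e]; exact (h2.mul_right _).sub (h1.mul_right _)
    rcases hp.dvd_or_dvd s with s | s
    · exact np3 (hp.dvd_of_dvd_pow s)
    have s2 : π ∣ q := by rcases hp.dvd_or_dvd s with h | h <;> exact h
    have s3 : π ∣ k := by
      have e : k = -q - f * (8 * l) := by rw [hqdef, hlf]; ring
      rw [e]; exact s2.neg_right.sub (h2.mul_right _)
    rw [hl] at s3
    exact cop_prime clf hp (hp.dvd_of_dvd_pow s3) h2
  obtain ⟨x, y, e1, e2, e3⟩ := cube_eis _ _ _ hf ctr f3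
  have e2' : x * y * (x - y) = -(8 * l * f + l ^ 3) := by rw [← e2, hqdef, hlf, hl]; ring
  have key : (y + 8 * l) * (x - y + 8 * l) * (-x + 8 * l) = 513 * l ^ 3 := by
    rw [e3] at e2'; linear_combination -e2'
  have l0 : l ≠ 0 := by rintro rfl; apply hC; rw [hlf]; ring
  have f0 : f ≠ 0 := by rintro rfl; apply hC; rw [hlf]; ring
  have bad : ∀ p : ℤ, Prime p → p ∣ l → p ∣ x → p ∣ y → False := by
    intro p hp a b c
    refine cop_prime clf hp a ?_
    rw [e3]
    have : x ^ 2 - x * y + y ^ 2 = x * (x - y) + y * y := by ring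
    rw [this]; exact (b.mul_right _).add (c.mul_right _)
  have bad2 : ∀ p : ℤ, Prime p → p ∣ l → (p ∣ y + 8 * l ∧ p ∣ x - y + 8 * l ∨
      p ∣ y + 8 * l ∧ p ∣ -x + 8 * l ∨ p ∣ x - y + 8 * l ∧ p ∣ -x + 8 * l) → False := by
    intro p hp pl hh
    have p8 : p ∣ 8 * l := pl.mul_left _
    rw [dvd_add_left p8, dvd_add_left p8, dvd_add_left p8, dvd_neg] at hh
    rcases hh with ⟨a, b⟩ | ⟨a, b⟩ | ⟨a, b⟩
    · exact bad p hp pl ((dvd_sub_left a).mp b) a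
    · exact bad p hp pl b a
    · exact bad p hp pl b ((dvd_sub_right b).mp a)
  have n3 : ¬ ((3 : ℤ) ∣ x + y) := by
    rintro ⟨m, hm⟩
    apply f3
    rw [e3]
    exact ⟨3 * m ^ 2 - x * y, by linear_combination (x + y + 3 * m) * hm⟩
  have d3 : (3 : ℤ) ∣ (y + 8 * l) * (x - y + 8 * l) * (-x + 8 * l) := by
    rw [key]; exact ⟨171 * l ^ 3, by ring⟩
  have main : ∃ A B C : ℤ, A ^ 3 + B ^ 3 + 8 * A * B * C = 19 * C ^ 3 ∧ IsCoprime A B ∧ C ∣ 3 * l ∧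
      (C = 0 → l = 0) := by
    rcases p3.dvd_or_dvd d3 with h | h
    · rcases p3.dvd_or_dvd h with h | h
      · exact caseA_aux key (by ring) h (by omega) (by omega) bad2
      · exact caseA_aux (F1 := x - y + 8 * l) (F2 := y + 8 * l) (F3 := -x + 8 * l)
          (by rw [← key]; ring) (by ring) h (by omega) (by omega)
          (fun p hp pl hh => bad2 p hp pl (by tauto))
    · exact caseA_aux (F1 := -x + 8 * l) (F2 := y + 8 * l) (F3 := x - y + 8 * l)
          (by rw [← key]; ring) (by ring) h (by omega) (by omega)
          (fun p hp pl hh => bad2 p hp pl (by tauto))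
  obtain ⟨A', B', C', g1, g2, g3, g4⟩ := main
  refine ⟨A', B', C', g1, g2, ?_, fun h0 => l0 (g4 h0)⟩
  have h1 : C'.natAbs ≤ (3 * l).natAbs :=
    Nat.le_of_dvd (Int.natAbs_pos.mpr (by omega)) (Int.natAbs_dvd_natAbs.mpr g3)
  have h2 : (3 * (3 * D)).natAbs = 9 * (l.natAbs * f.natAbs) := by
    rw [hlf]; simp only [Int.natAbs_mul]; simp; ring
  have h3 : 1 ≤ f.natAbs := Int.natAbs_pos.mpr f0
  have h4 : 0 < l.natAbs := Int.natAbs_pos.mpr l0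
  rw [h2]
  have h5 : (3 * l).natAbs = 3 * l.natAbs := by simp [Int.natAbs_mul]
  nlinarith

theorem claimA (n : ℕ) : ∀ A B C : ℤ, C.natAbs = n →
    A ^ 3 + B ^ 3 + 8 * A * B * C = 19 * C ^ 3 → IsCoprime A B → C = 0 := by
  induction n using Nat.strong_induction_on with
  | _ n ih =>
    intro A B C hn h hc
    by_contra hC
    have : ∃ A' B' C' : ℤ, A' ^ 3 + B' ^ 3 + 8 * A' * B' * C' = 19 * C' ^ 3 ∧ IsCoprime A' B' ∧
        C'.natAbs < C.natAbs ∧ C' ≠ 0 := by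
      by_cases h3 : (3 : ℤ) ∣ C
      · exact stepA2 h hc hC h3
      · exact stepA1 h hc hC h3
    obtain ⟨A', B', C', h1, h2, h3, h4⟩ := this
    exact h4 (ih _ (hn ▸ h3) A' B' C' rfl h1 h2)

end X19
namespace X19

theorem rat_form (x y : ℚ) (a b c d : ℤ) (h : y ^ 2 + a * y = x ^ 3 + b * x ^ 2 + c * x + d) :
    ∃ n m e : ℤ, e ≠ 0 ∧ IsCoprime n e ∧ x = n / e ^ 2 ∧ y = m / e ^ 3 := by
  have hD : (x.den : ℚ) ≠ 0 := by exact_mod_cast x.den_nz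
  have hF : (y.den : ℚ) ≠ 0 := by exact_mod_cast y.den_nz
  have cx : IsCoprime x.num (x.den : ℤ) := Rat.isCoprime_num_den x
  have cy : IsCoprime y.num (y.den : ℤ) := Rat.isCoprime_num_den y
  have hx : x = x.num / x.den := (Rat.num_div_den x).symm
  have hy : y = y.num / y.den := (Rat.num_div_den y).symm
  have key : y.num * (y.num + a * y.den) * (x.den : ℤ) ^ 3 =
      (x.num ^ 3 + b * x.num ^ 2 * x.den + c * x.num * x.den ^ 2 + d * x.den ^ 3) *
        (y.den : ℤ) ^ 2 := by
    rw [hx, hy] at h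
    field_simp at h
    have : ((y.num * (y.num + a * y.den) * (x.den : ℤ) ^ 3 : ℤ) : ℚ) =
      (((x.num ^ 3 + b * x.num ^ 2 * x.den + c * x.num * x.den ^ 2 + d * x.den ^ 3) *
        (y.den : ℤ) ^ 2 : ℤ) : ℚ) := by
      push_cast
      linear_combination h
    exact_mod_cast this
  have c1 : IsCoprime ((x.den : ℤ) ^ 3)
      (x.num ^ 3 + b * x.num ^ 2 * x.den + c * x.num * x.den ^ 2 + d * x.den ^ 3) := by
    apply IsCoprime.pow_left
    have e : x.num ^ 3 + b * x.num ^ 2 * x.den + c * x.num * x.den ^ 2 + d * x.den ^ 3 =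
      x.num ^ 3 + x.den * (b * x.num ^ 2 + c * x.num * x.den + d * x.den ^ 2) := by ring
    rw [e]
    exact IsCoprime.add_mul_left_right (cx.symm.pow_right) _
  have c2 : IsCoprime ((y.den : ℤ) ^ 2) (y.num * (y.num + a * y.den)) := by
    apply IsCoprime.pow_left
    apply IsCoprime.mul_right cy.symm
    exact IsCoprime.add_mul_right_right cy.symm _
  have d1 : (x.den : ℤ) ^ 3 ∣ (y.den : ℤ) ^ 2 := by
    apply c1.dvd_of_dvd_mul_left; rw [← key]; exact Dvd.intro_left _ rfl
  have d2 : (y.den : ℤ) ^ 2 ∣ (x.den : ℤ) ^ 3 := by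
    apply c2.dvd_of_dvd_mul_left; rw [key]; exact Dvd.intro_left _ rfl
  have d1' : x.den ^ 3 ∣ y.den ^ 2 := by exact_mod_cast d1
  have d2' : y.den ^ 2 ∣ x.den ^ 3 := by exact_mod_cast d2
  have hE := Nat.dvd_antisymm d1' d2'
  have hdd : x.den ∣ y.den := by
    apply (Nat.pow_dvd_pow_iff (n := 2) (by norm_num)).mp
    rw [← hE]; exact pow_dvd_pow _ (by norm_num)
  obtain ⟨e, he⟩ := hdd
  have hDe : x.den = e ^ 2 := by
    rw [he] at hE
    have h0 : 0 < x.den ^ 2 := by have := x.den_pos; positivity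
    apply Nat.eq_of_mul_eq_mul_left h0
    linarith
  have he3 : y.den = e ^ 3 := by rw [he, hDe]; ring
  have he0 : e ≠ 0 := by
    rintro rfl
    exact x.den_nz (by rw [hDe]; norm_num)
  refine ⟨x.num, y.num, e, by exact_mod_cast he0, ?_, ?_, ?_⟩
  · rw [hDe] at cx
    push_cast at cx
    exact (IsCoprime.pow_right_iff (by norm_num)).mp cx
  · conv_lhs => rw [hx]
    rw [hDe]; push_cast; rfl
  · conv_lhs => rw [hy]
    rw [he3]; push_cast; rfl

theorem intA (m n e : ℤ) (he : e ≠ 0) (hc : IsCoprime n e)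
    (h : m * (m + 8 * n * e + 19 * e ^ 3) = n ^ 3) : n = 0 := by
  by_contra hn
  by_cases h19 : (19 : ℤ) ∣ n ∧ (19 : ℤ) ∣ m
  · obtain ⟨⟨n1, rfl⟩, ⟨m1, rfl⟩⟩ := h19
    have h1 : m1 * (m1 + 8 * n1 * e + e ^ 3) = 19 * n1 ^ 3 := by linarith
    have cn : IsCoprime n1 e := hc.of_mul_left_right
    have n10 : n1 ≠ 0 := by rintro rfl; exact hn (by ring)
    have c1 : IsCoprime m1 (m1 + 8 * n1 * e + e ^ 3) := by
      apply cop_of_prime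
      intro p hp a b
      have pn : p ∣ n1 := sq_dvd_19 hp (by rw [← h1]; exact mul_dvd_mul a b)
      have pe : p ∣ e ^ 3 := by
        have : e ^ 3 = (m1 + 8 * n1 * e + e ^ 3) - m1 - n1 * (8 * e) := by ring
        rw [this]; exact (b.sub a).sub (pn.mul_right _)
      exact cop_prime cn hp pn (hp.dvd_of_dvd_pow pe)
    have d : (19 : ℤ) ∣ m1 * (m1 + 8 * n1 * e + e ^ 3) := Dvd.intro _ h1.symm
    rcases p19.dvd_or_dvd d with ⟨k, hk⟩ | ⟨k, hk⟩
    · have h2 : k * (m1 + 8 * n1 * e + e ^ 3) = n1 ^ 3 := by rw [hk] at h1 ⊢; linarith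
      obtain ⟨u, v, hu, hv, huv⟩ := cubes (by rw [hk] at c1 ⊢; exact c1.of_mul_left_right) h2
      have := claimA _ e (-v) (-u) rfl (by rw [hk, hu, huv] at hv; linarith)
        (by rw [huv] at cn; exact (cn.of_mul_left_right).symm.neg_right)
      apply n10; rw [huv]
      have : u = 0 := by linarith
      rw [this]; ring
    · have h2 : m1 * k = n1 ^ 3 := by rw [hk] at h1; linarith
      obtain ⟨u, v, hu, hv, huv⟩ := cubes (by rw [hk] at c1; exact c1.of_mul_right_right) h2
      have := claimA _ u e v rfl (by rw [hu, hv, huv] at hk; linarith)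
        (by rw [huv] at cn; exact (cn.of_mul_left_left))
      apply n10; rw [huv, this]; ring
  · have c1 : IsCoprime m (m + 8 * n * e + 19 * e ^ 3) := by
      apply cop_of_prime
      intro p hp a b
      have pn : p ∣ n := by
        apply hp.dvd_of_dvd_pow (n := 3); rw [← h]; exact a.mul_right _
      have pe : p ∣ 19 * e ^ 3 := by
        have : 19 * e ^ 3 = (m + 8 * n * e + 19 * e ^ 3) - m - n * (8 * e) := by ring
        rw [this]; exact (b.sub a).sub (pn.mul_right _)
      rcases hp.dvd_or_dvd pe with q | q
      · have := prime_dvd_symm hp p19 q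
        exact h19 ⟨this.trans pn, this.trans a⟩
      · exact cop_prime hc hp pn (hp.dvd_of_dvd_pow q)
    obtain ⟨u, v, hu, hv, huv⟩ := cubes c1 h
    exact he (claimA _ v (-u) e rfl (by rw [hu, huv] at hv; linarith)
      (by rw [hv, hu] at c1; exact (cop_cube c1).symm.neg_right))

theorem ratA (x y : ℚ) (h : y ^ 2 + y = x ^ 3 + x ^ 2 - 9 * x - 15) :
    x = 5 ∧ (y = 9 ∨ y = -10) := by
  obtain ⟨n, m, e, he, hc, hx, hy⟩ := rat_form x y 1 1 (-9) (-15) (by push_cast; linarith)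
  have heQ : (e : ℚ) ≠ 0 := by exact_mod_cast he
  have h0 : (m - 4 * (n - 5 * e ^ 2) * e - 9 * e ^ 3) *
      ((m - 4 * (n - 5 * e ^ 2) * e - 9 * e ^ 3) + 8 * (n - 5 * e ^ 2) * e + 19 * e ^ 3)
      = (n - 5 * e ^ 2) ^ 3 := by
    rw [hx, hy] at h
    field_simp at h
    have : ((m : ℚ) - 4 * (n - 5 * e ^ 2) * e - 9 * e ^ 3) *
      ((m - 4 * (n - 5 * e ^ 2) * e - 9 * e ^ 3) + 8 * (n - 5 * e ^ 2) * e + 19 * e ^ 3)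
      = (n - 5 * e ^ 2) ^ 3 := by linear_combination h
    exact_mod_cast this
  have hc' : IsCoprime (n - 5 * e ^ 2) e := by
    have : n - 5 * e ^ 2 = n + e * (-5 * e) := by ring
    rw [this]; exact IsCoprime.add_mul_left_left hc _
  have h1 := intA _ _ _ he hc' h0
  have h2 : x = 5 := by
    have : (n : ℚ) = 5 * e ^ 2 := by
      have : n = 5 * e ^ 2 := by linarith
      exact_mod_cast this
    rw [hx, this]; field_simp
  refine ⟨h2, ?_⟩
  rw [h2] at h
  have : (y - 9) * (y + 10) = 0 := by linarith
  rcases mul_eq_zero.mp this with h | h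
  · left; linarith
  · right; linarith

end X19
namespace X19

theorem p2 : Prime (2 : ℤ) := Int.prime_two

theorem sq_dvd' {p a : ℤ} (hp : Prime p) (h : p ∣ a ^ 2) : p ∣ a := hp.dvd_of_dvd_pow h

/-- first equation to second equation, trivial class -/
theorem stepB1a {a b E : ℤ} (hE : E ≠ 0)
    (h : 3 * a ^ 2 * b - 2 * b ^ 3 = 3 * (a ^ 2 + 2 * b ^ 2) * E + 19 * E ^ 3)
    (hc : IsCoprime (a ^ 2 + 2 * b ^ 2) E) :
    ∃ n e m : ℤ, m ^ 2 - 6 * (n * e + 3 * e ^ 3) ^ 2 = n ^ 3 ∧ IsCoprime n e ∧ e ≠ 0 ∧ e ∣ E := by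
  have hb : (3 : ℤ) ∣ b - E := by
    apply p3.dvd_of_dvd_pow (n := 3)
    exact ⟨b ^ 3 + 6 * E ^ 3 + (a ^ 2 + 2 * b ^ 2) * E - a ^ 2 * b - b ^ 2 * E + b * E ^ 2, by linarith⟩
  obtain ⟨k, hk⟩ := hb
  obtain rfl : b = E + 3 * k := by linarith
  have hk1 : k * (a ^ 2 - 6 * (k + E) ^ 2) = 3 * E ^ 3 := by linarith
  have bad : ∀ p : ℤ, Prime p → p ∣ a → p ∣ E → p ∣ 3 * k → False := by
    intro p hp ha he hk
    refine cop_prime hc hp ?_ he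
    have : a ^ 2 + 2 * (E + 3 * k) ^ 2 = a * a + (E + 3 * k) * (2 * (E + 3 * k)) := by ring
    rw [this]
    exact (ha.mul_right _).add ((he.add hk).mul_right _)
  by_cases ha : (3 : ℤ) ∣ a
  · obtain ⟨a', rfl⟩ := ha
    have h1 : k * (3 * a' ^ 2 - 2 * (k + E) ^ 2) = E ^ 3 := by linarith
    have c1 : IsCoprime k (3 * a' ^ 2 - 2 * (k + E) ^ 2) := by
      apply cop_of_prime
      intro p hp u v
      have pE : p ∣ E := by
        apply hp.dvd_of_dvd_pow (n := 3); rw [← h1]; exact u.mul_right _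
      have pa : p ∣ (3 * a') ^ 2 := by
        have : (3 * a') ^ 2 = (3 * a' ^ 2 - 2 * (k + E) ^ 2) * 3 + (k + E) * (6 * (k + E)) := by ring
        rw [this]; exact (v.mul_right _).add ((u.add pE).mul_right _)
      exact bad p hp (hp.dvd_of_dvd_pow pa) pE (u.mul_left _)
    obtain ⟨κ, g, e1, e2, e3⟩ := cubes c1 h1
    refine ⟨3 * g, κ, 9 * a', ?_, ?_, ?_, ?_⟩
    · rw [e1, e3] at e2; linarith
    · apply IsCoprime.mul_left
      · apply (p3.irreducible.coprime_iff_not_dvd).mpr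
        intro hz
        exact bad 3 p3 (Dvd.intro _ rfl) (by rw [e3]; exact hz.mul_right _) (Dvd.intro _ rfl)
      · rw [e2, e1] at c1; exact (cop_cube c1).symm
    · rintro rfl; apply hE; rw [e3]; ring
    · exact ⟨g, e3⟩
  · have h3 : (3 : ℤ) ∣ k := by
      have : (3 : ℤ) ∣ k * (a ^ 2 - 6 * (k + E) ^ 2) := ⟨_, hk1⟩
      refine (p3.dvd_or_dvd this).resolve_right ?_
      intro hh
      apply ha
      apply p3.dvd_of_dvd_pow (n := 2)
      omega
    obtain ⟨k2, rfl⟩ := h3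
    have h1 : k2 * (a ^ 2 - 6 * (3 * k2 + E) ^ 2) = E ^ 3 := by linarith
    have c1 : IsCoprime k2 (a ^ 2 - 6 * (3 * k2 + E) ^ 2) := by
      apply cop_of_prime
      intro p hp u v
      have pE : p ∣ E := by
        apply hp.dvd_of_dvd_pow (n := 3); rw [← h1]; exact u.mul_right _
      have pa : p ∣ a ^ 2 := by
        have : a ^ 2 = (a ^ 2 - 6 * (3 * k2 + E) ^ 2) + (3 * k2 + E) * (6 * (3 * k2 + E)) := by ring
        rw [this]; exact v.add (((u.mul_left _).add pE).mul_right _)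
      exact bad p hp (hp.dvd_of_dvd_pow pa) pE ((u.mul_left _).mul_left _)
    obtain ⟨κ, g, e1, e2, e3⟩ := cubes c1 h1
    refine ⟨g, κ, a, ?_, ?_, ?_, ?_⟩
    · rw [e1, e3] at e2; linarith
    · rw [e2, e1] at c1; exact (cop_cube c1).symm
    · rintro rfl; apply hE; rw [e3]; ring
    · exact ⟨g, e3⟩

/-- the nontrivial class for the first equation is impossible -/
theorem stepB1b {a b E : ℤ}
    (h : 3 * a ^ 2 * b - 2 * b ^ 3 + 3 * (a ^ 3 - 6 * a * b ^ 2) =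
      3 * (a ^ 2 + 2 * b ^ 2) * E + E ^ 3)
    (hc : IsCoprime (a ^ 2 + 2 * b ^ 2) E) : False := by
  have hb : (3 : ℤ) ∣ b - E := by
    apply p3.dvd_of_dvd_pow (n := 3)
    exact ⟨b ^ 3 - b ^ 2 * E + b * E ^ 2 - (a ^ 2 * b + a ^ 3 - 6 * a * b ^ 2
      - (a ^ 2 + 2 * b ^ 2) * E), by linarith⟩
  obtain ⟨k, hk⟩ := hb
  obtain rfl : b = E + 3 * k := by linarith
  have h3a : (3 : ℤ) ∣ a := by
    apply p3.dvd_of_dvd_pow (n := 3)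
    exact ⟨-a ^ 2 * k + E ^ 3 + 6 * E ^ 2 * k + 12 * E * k ^ 2 + 6 * k ^ 3 +
      2 * a * (E + 3 * k) ^ 2, by linarith⟩
  obtain ⟨a', rfl⟩ := h3a
  have h3E : (3 : ℤ) ∣ E := by
    apply p3.dvd_of_dvd_pow (n := 3)
    exact ⟨3 * a' ^ 3 + 3 * a' ^ 2 * k - 2 * E ^ 2 * k - 4 * E * k ^ 2 - 2 * k ^ 3 -
      2 * a' * (E + 3 * k) ^ 2, by linarith⟩
  refine cop_prime hc p3 ?_ h3E
  obtain ⟨t, rfl⟩ := h3E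
  exact ⟨3 * a' ^ 2 + 6 * (t + k) ^ 2, by ring⟩

theorem stepB1 {N E M : ℤ} (h : M ^ 2 + 2 * (3 * N * E + 19 * E ^ 3) ^ 2 = N ^ 3)
    (hc : IsCoprime N E) (hE : E ≠ 0) :
    ∃ n e m : ℤ, m ^ 2 - 6 * (n * e + 3 * e ^ 3) ^ 2 = n ^ 3 ∧ IsCoprime n e ∧ e ≠ 0 ∧ e ∣ E := by
  have hodd : ¬ (2 : ℤ) ∣ N := by
    rintro ⟨N', rfl⟩
    have h1 : (2 : ℤ) ∣ M := sq_dvd' p2 ⟨4 * N' ^ 3 - (3 * (2 * N') * E + 19 * E ^ 3) ^ 2, by linarith⟩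
    obtain ⟨M', rfl⟩ := h1
    have h2 : (2 : ℤ) ∣ 3 * (2 * N') * E + 19 * E ^ 3 :=
      sq_dvd' p2 ⟨2 * N' ^ 3 - M' ^ 2, by linarith⟩
    have h3 : (2 : ℤ) ∣ E ^ 3 := by
      obtain ⟨t, ht⟩ := h2
      exact ⟨t - 3 * N' * E - 9 * E ^ 3, by linarith⟩
    exact cop_prime hc p2 (Dvd.intro _ rfl) (p2.dvd_of_dvd_pow h3)
  by_cases h19 : (19 : ℤ) ∣ N
  · exfalso
    obtain ⟨N1, rfl⟩ := h19
    have h1 : (19 : ℤ) ∣ M := sq_dvd' p19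
      ⟨19 ^ 2 * N1 ^ 3 - 38 * (3 * N1 * E + E ^ 3) ^ 2, by linarith⟩
    obtain ⟨M1, rfl⟩ := h1
    have h2 : M1 ^ 2 + 2 * (3 * N1 * E + E ^ 3) ^ 2 = 19 * N1 ^ 3 := by linarith
    have hodd1 : ¬ (2 : ℤ) ∣ N1 := fun hh => hodd (hh.mul_left _)
    have c1 : IsCoprime N1 E := hc.of_mul_left_right
    have wl : ∀ M1 : ℤ, M1 ^ 2 + 2 * (3 * N1 * E + E ^ 3) ^ 2 = 19 * N1 ^ 3 →
        (19 : ℤ) ∣ M1 + 6 * (3 * N1 * E + E ^ 3) → False := by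
      intro M1 h2 hd
      obtain ⟨c, hcc⟩ : ∃ c, c = 3 * N1 * E + E ^ 3 := ⟨_, rfl⟩
      rw [← hcc] at h2 hd
      obtain ⟨X, hX⟩ := hd
      obtain rfl : M1 = 19 * X - 6 * c := by linarith
      have h3 : X ^ 2 + 2 * (c - 3 * X) ^ 2 = N1 ^ 3 := by linarith
      have c2 : IsCoprime (2 * X) N1 := by
        apply cop_of_prime
        intro p hp u v
        have np2 : ¬ p ∣ 2 := fun hh => hodd1 ((prime_dvd_symm hp p2 hh).trans v)
        have pX := (hp.dvd_or_dvd u).resolve_left np2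
        have pY : p ∣ 2 * (c - 3 * X) ^ 2 := by
          have : 2 * (c - 3 * X) ^ 2 = N1 * N1 ^ 2 - X * X := by linarith
          rw [this]; exact (v.mul_right _).sub (pX.mul_right _)
        have pY := hp.dvd_of_dvd_pow ((hp.dvd_or_dvd pY).resolve_left np2)
        have pE : p ∣ E ^ 3 := by
          have : E ^ 3 = (c - 3 * X) + X * 3 - N1 * (3 * E) := by linarith
          rw [this]; exact (pY.add (pX.mul_right _)).sub (v.mul_right _)
        exact cop_prime c1 hp v (hp.dvd_of_dvd_pow pE)
      obtain ⟨a, b, e1, e2, e3⟩ := cube_m2 _ _ _ h3 c2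
      apply stepB1b (a := a) (b := b) (E := E)
      · rw [← e3, ← e2, ← e1]; linarith
      · rw [← e3]; exact c1
    have hd : (19 : ℤ) ∣ (M1 + 6 * (3 * N1 * E + E ^ 3)) * (-M1 + 6 * (3 * N1 * E + E ^ 3)) :=
      ⟨2 * (3 * N1 * E + E ^ 3) ^ 2 - N1 ^ 3, by linarith⟩
    rcases p19.dvd_or_dvd hd with hd | hd
    · exact wl M1 h2 hd
    · exact wl (-M1) (by linarith) hd
  · have c2 : IsCoprime (2 * M) N := by
      apply cop_of_prime
      intro p hp u v
      have np2 : ¬ p ∣ 2 := fun hh => hodd ((prime_dvd_symm hp p2 hh).trans v)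
      have pX := (hp.dvd_or_dvd u).resolve_left np2
      have pY : p ∣ 2 * (3 * N * E + 19 * E ^ 3) ^ 2 := by
        have : 2 * (3 * N * E + 19 * E ^ 3) ^ 2 = N * N ^ 2 - M * M := by linarith
        rw [this]; exact (v.mul_right _).sub (pX.mul_right _)
      have pY := hp.dvd_of_dvd_pow ((hp.dvd_or_dvd pY).resolve_left np2)
      have pE : p ∣ 19 * E ^ 3 := by
        have : 19 * E ^ 3 = (3 * N * E + 19 * E ^ 3) - N * (3 * E) := by linarith
        rw [this]; exact pY.sub (v.mul_right _)
      rcases hp.dvd_or_dvd pE with h | h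
      · exact h19 ((prime_dvd_symm hp p19 h).trans v)
      · exact cop_prime hc hp v (hp.dvd_of_dvd_pow h)
    obtain ⟨a, b, e1, e2, e3⟩ := cube_m2 _ _ _ h c2
    apply stepB1a (a := a) (b := b) hE
    · rw [← e3, ← e2]
    · rw [← e3]; exact hc

theorem mod19_zero : ∀ x y : ZMod 19,
    2 * (x ^ 3 + 18 * x * y ^ 2) + 5 * (3 * x ^ 2 * y + 6 * y ^ 3) = 0 → x = 0 ∧ y = 0 := by
  decide +kernel

theorem mod19_one : ∀ x y : ZMod 19,
    2 * (x ^ 3 + 18 * x * y ^ 2) + 5 * (3 * x ^ 2 * y + 6 * y ^ 3) ≠ x ^ 2 - 6 * y ^ 2 + 3 := by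
  decide +kernel

theorem mod19 : ∀ x y e : ZMod 19,
    2 * (x ^ 3 + 18 * x * y ^ 2) + 5 * (3 * x ^ 2 * y + 6 * y ^ 3) =
      (x ^ 2 - 6 * y ^ 2) * e + 3 * e ^ 3 → x = 0 ∧ y = 0 ∧ e = 0 := by
  intro x y e h
  have := Fact.mk (by norm_num : Nat.Prime 19)
  by_cases he : e = 0
  · subst he
    obtain ⟨h1, h2⟩ := mod19_zero x y (by linear_combination h)
    exact ⟨h1, h2, rfl⟩
  · exfalso
    apply mod19_one (x / e) (y / e)
    field_simp
    linear_combination h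

theorem noclass {x y e : ℤ}
    (h : 2 * (x ^ 3 + 18 * x * y ^ 2) + 5 * (3 * x ^ 2 * y + 6 * y ^ 3) =
      (x ^ 2 - 6 * y ^ 2) * e + 3 * e ^ 3) (hc : IsCoprime (x ^ 2 - 6 * y ^ 2) e) : False := by
  have h' := congrArg (Int.cast : ℤ → ZMod 19) h
  push_cast at h'
  obtain ⟨h1, h2, h3⟩ := mod19 _ _ _ h'
  have d1 : (19 : ℤ) ∣ x := (ZMod.intCast_zmod_eq_zero_iff_dvd x 19).mp h1
  have d2 : (19 : ℤ) ∣ y := (ZMod.intCast_zmod_eq_zero_iff_dvd y 19).mp h2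
  have d3 : (19 : ℤ) ∣ e := (ZMod.intCast_zmod_eq_zero_iff_dvd e 19).mp h3
  refine cop_prime hc p19 ?_ d3
  have : x ^ 2 - 6 * y ^ 2 = x * x - y * (6 * y) := by ring
  rw [this]; exact (d1.mul_right _).sub (d2.mul_right _)

theorem stepB2 {n e m : ℤ} (h : m ^ 2 - 6 * (n * e + 3 * e ^ 3) ^ 2 = n ^ 3) (hc : IsCoprime n e) :
    ∃ x y : ℤ, 3 * x ^ 2 * y + 6 * y ^ 3 = (x ^ 2 - 6 * y ^ 2) * e + 3 * e ^ 3 ∧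
      IsCoprime (x ^ 2 - 6 * y ^ 2) e := by
  have hodd : ¬ (2 : ℤ) ∣ n := by
    rintro ⟨N', rfl⟩
    have h1 : (2 : ℤ) ∣ m := sq_dvd' p2 ⟨4 * N' ^ 3 + 3 * (2 * N' * e + 3 * e ^ 3) ^ 2, by linarith⟩
    obtain ⟨M', rfl⟩ := h1
    have h2 : (2 : ℤ) ∣ 2 * N' * e + 3 * e ^ 3 :=
      sq_dvd' p2 ⟨M' ^ 2 - 2 * N' ^ 3 - (2 * N' * e + 3 * e ^ 3) ^ 2, by linarith⟩
    have h3 : (2 : ℤ) ∣ e ^ 3 := by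
      obtain ⟨t, ht⟩ := h2
      exact ⟨t - N' * e - e ^ 3, by linarith⟩
    exact cop_prime hc p2 (Dvd.intro _ rfl) (p2.dvd_of_dvd_pow h3)
  by_cases h3 : (3 : ℤ) ∣ n
  · obtain ⟨n1, rfl⟩ := h3
    have h1 : (3 : ℤ) ∣ m := sq_dvd' p3
      ⟨9 * n1 ^ 3 + 18 * (n1 * e + e ^ 3) ^ 2, by linarith⟩
    obtain ⟨m', rfl⟩ := h1
    have h1 : (3 : ℤ) ∣ m' := sq_dvd' p3
      ⟨n1 ^ 3 + 2 * (n1 * e + e ^ 3) ^ 2, by linarith⟩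
    obtain ⟨μ, rfl⟩ := h1
    obtain ⟨c, hcc⟩ : ∃ c, c = n1 * e + e ^ 3 := ⟨_, rfl⟩
    have h2 : (3 * μ - 2 * c) ^ 2 - 6 * (c - μ) ^ 2 = n1 ^ 3 := by rw [hcc]; linarith
    have hodd1 : ¬ (2 : ℤ) ∣ n1 := fun hh => hodd (hh.mul_left _)
    have c1 : IsCoprime n1 e := hc.of_mul_left_right
    have pce : ∀ p : ℤ, Prime p → p ∣ n1 → p ∣ c → False := by
      intro p hp u v
      have pE : p ∣ e ^ 3 := by
        have : e ^ 3 = c - n1 * e := by linarith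
        rw [this]; exact v.sub (u.mul_right _)
      exact cop_prime c1 hp u (hp.dvd_of_dvd_pow pE)
    have n13 : ¬ (3 : ℤ) ∣ n1 := by
      intro hh
      apply pce 3 p3 hh
      have : (3 : ℤ) ∣ 2 * c ^ 2 := by
        have : 2 * c ^ 2 = 3 * μ ^ 2 - n1 * n1 ^ 2 := by linarith
        rw [this]; exact (Dvd.intro _ rfl : (3 : ℤ) ∣ 3 * μ ^ 2).sub (hh.mul_right _)
      exact sq_dvd' p3 (by omega)
    have c2 : IsCoprime (2 * (3 * μ - 2 * c)) n1 := by
      apply cop_of_prime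
      intro p hp u v
      have np2 : ¬ p ∣ 2 := fun hh => hodd1 ((prime_dvd_symm hp p2 hh).trans v)
      have np3 : ¬ p ∣ 3 := fun hh => n13 ((prime_dvd_symm hp p3 hh).trans v)
      have pX := (hp.dvd_or_dvd u).resolve_left np2
      have pY : p ∣ 2 * (3 * (c - μ) ^ 2) := by
        have : 2 * (3 * (c - μ) ^ 2) = (3 * μ - 2 * c) * (3 * μ - 2 * c) - n1 * n1 ^ 2 := by linarith
        rw [this]; exact (pX.mul_right _).sub (v.mul_right _)
      have pY := sq_dvd' hp ((hp.dvd_or_dvd ((hp.dvd_or_dvd pY).resolve_left np2)).resolve_left np3)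
      apply pce p hp v
      have : c = (3 * μ - 2 * c) + (c - μ) * 3 := by ring
      rw [this]; exact pX.add (pY.mul_right _)
    obtain ⟨a, b, P, Q, rfl, rfl, e1, e2⟩ := cube_s6 _ _ _ h2 c2
    have hn : 3 * n1 = (3 * a + 6 * b) ^ 2 - 6 * (a + 3 * b) ^ 2 := by rw [e1]; ring
    have hn2 : 3 * n1 = (5 * (3 * a + 6 * b) - 12 * (a + 3 * b)) ^ 2 -
      6 * (5 * (a + 3 * b) - 2 * (3 * a + 6 * b)) ^ 2 := by rw [e1]; ring
    have hn3 : 3 * n1 = (-(3 * a + 6 * b)) ^ 2 - 6 * (a + 3 * b) ^ 2 := by rw [e1]; ring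
    rcases e2 with ⟨e2, e3⟩ | ⟨e2, e3⟩ | ⟨e2, e3⟩
    · exfalso
      have : c = (3 * μ - 2 * c) + (c - μ) * 3 := by ring
      rw [e2, e3] at this
      apply noclass (x := -(3 * a + 6 * b)) (y := a + 3 * b) (e := e)
      · rw [← hn3]; linarith
      · rw [← hn3]; exact hc
    · have : c = (3 * μ - 2 * c) + (c - μ) * 3 := by ring
      rw [e2, e3] at this
      refine ⟨3 * a + 6 * b, a + 3 * b, ?_, ?_⟩
      · rw [← hn]; linarith
      · rw [← hn]; exact hc
    · exfalso
      have : c = (3 * μ - 2 * c) + (c - μ) * 3 := by ring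
      rw [e2, e3] at this
      apply noclass (x := 5 * (3 * a + 6 * b) - 12 * (a + 3 * b))
        (y := 5 * (a + 3 * b) - 2 * (3 * a + 6 * b)) (e := e)
      · rw [← hn2]; linarith
      · rw [← hn2]; exact hc
  · have c2 : IsCoprime (2 * m) n := by
      apply cop_of_prime
      intro p hp u v
      have np2 : ¬ p ∣ 2 := fun hh => hodd ((prime_dvd_symm hp p2 hh).trans v)
      have np3 : ¬ p ∣ 3 := fun hh => h3 ((prime_dvd_symm hp p3 hh).trans v)
      have pX := (hp.dvd_or_dvd u).resolve_left np2
      have pY : p ∣ 2 * (3 * (n * e + 3 * e ^ 3) ^ 2) := by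
        have : 2 * (3 * (n * e + 3 * e ^ 3) ^ 2) = m * m - n * n ^ 2 := by linarith
        rw [this]; exact (pX.mul_right _).sub (v.mul_right _)
      have pY := sq_dvd' hp ((hp.dvd_or_dvd ((hp.dvd_or_dvd pY).resolve_left np2)).resolve_left np3)
      have pE : p ∣ 3 * e ^ 3 := by
        have : 3 * e ^ 3 = (n * e + 3 * e ^ 3) - n * e := by ring
        rw [this]; exact pY.sub (v.mul_right _)
      exact cop_prime hc hp v (hp.dvd_of_dvd_pow ((hp.dvd_or_dvd pE).resolve_left np3))
    obtain ⟨a, b, P, Q, rfl, rfl, e1, e2⟩ := cube_s6 _ _ _ h c2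
    rcases e2 with ⟨e2, e3⟩ | ⟨e2, e3⟩ | ⟨e2, e3⟩
    · exact ⟨a, b, by rw [← e1]; linarith, by rw [← e1]; exact hc⟩
    · exfalso
      apply noclass (x := a) (y := b) (e := e)
      · rw [← e1]; linarith
      · rw [← e1]; exact hc
    · exfalso
      have e1' : n = (-a) ^ 2 - 6 * b ^ 2 := by rw [e1]; ring
      apply noclass (x := -a) (y := b) (e := e)
      · rw [← e1']; linarith
      · rw [← e1']; exact hc

theorem stepB3a {X z L e : ℤ} (h : L * (X ^ 2 + 2 * z ^ 2) = 19 * e ^ 3) (hz : z = L + 3 * e)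
    (hc : IsCoprime L (X ^ 2 + 2 * z ^ 2)) :
    ∃ N l M f : ℤ, M ^ 2 + 2 * (3 * N * l + 19 * l ^ 3) ^ 2 = N ^ 3 ∧ IsCoprime N l ∧ e = l * f ∧
      (X ^ 2 + 2 * z ^ 2 = f ^ 3 ∨ X ^ 2 + 2 * z ^ 2 = 19 * f ^ 3) := by
  have hd : (19 : ℤ) ∣ L * (X ^ 2 + 2 * z ^ 2) := Dvd.intro _ h.symm
  rcases p19.dvd_or_dvd hd with ⟨k, hk⟩ | ⟨k, hk⟩
  · have h1 : k * (X ^ 2 + 2 * z ^ 2) = e ^ 3 := by rw [hk] at h; linarith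
    have c1 : IsCoprime k (X ^ 2 + 2 * z ^ 2) := by rw [hk] at hc; exact hc.of_mul_left_right
    obtain ⟨l, f, e1, e2, e3⟩ := cubes c1 h1
    refine ⟨f, l, X, f, ?_, ?_, e3, Or.inl e2⟩
    · have : 3 * f * l + 19 * l ^ 3 = z := by rw [hz, hk, e1, e3]; ring
      rw [this, e2]
    · rw [e1, e2] at c1; exact (cop_cube c1).symm
  · have h1 : L * k = e ^ 3 := by rw [hk] at h; linarith
    have c1 : IsCoprime L k := by rw [hk] at hc; exact hc.of_mul_right_right
    have c2 : IsCoprime L 19 := by rw [hk] at hc; exact hc.of_mul_right_left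
    obtain ⟨l, f, e1, e2, e3⟩ := cubes c1 h1
    refine ⟨19 * f, l, 19 * X, f, ?_, ?_, e3, Or.inr (by rw [hk, e2])⟩
    · have : 3 * (19 * f) * l + 19 * l ^ 3 = 19 * z := by rw [hz, e1, e3]; ring
      rw [this]
      rw [e2] at hk
      linarith
    · apply IsCoprime.mul_left
      · rw [e1] at c2; exact ((IsCoprime.pow_left_iff (by norm_num)).mp c2).symm
      · rw [e1, e2] at c1; exact (cop_cube c1).symm

theorem stepB3 {x y e : ℤ} (h : 3 * x ^ 2 * y + 6 * y ^ 3 = (x ^ 2 - 6 * y ^ 2) * e + 3 * e ^ 3)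
    (hc : IsCoprime (x ^ 2 - 6 * y ^ 2) e) (he : e ≠ 0) :
    ∃ N l M : ℤ, M ^ 2 + 2 * (3 * N * l + 19 * l ^ 3) ^ 2 = N ^ 3 ∧ IsCoprime N l ∧ l ≠ 0 ∧
      l.natAbs < e.natAbs := by
  have bad : ∀ p : ℤ, Prime p → p ∣ x → p ∣ y → p ∣ e → False := by
    intro p hp u v w
    refine cop_prime hc hp ?_ w
    have : x ^ 2 - 6 * y ^ 2 = x * x - y * (6 * y) := by ring
    rw [this]; exact (u.mul_right _).sub (v.mul_right _)
  by_cases h3 : (3 : ℤ) ∣ e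
  · obtain ⟨e1, rfl⟩ := h3
    have h1 : (y - e1) * (x ^ 2 + 2 * (y + 2 * e1) ^ 2) = 19 * e1 ^ 3 := by linarith
    have c1 : IsCoprime (y - e1) (x ^ 2 + 2 * (y + 2 * e1) ^ 2) := by
      apply cop_of_prime
      intro p hp u v
      have pe : p ∣ e1 := sq_dvd_19 hp (by rw [← h1]; exact mul_dvd_mul u v)
      have py : p ∣ y := (dvd_sub_left pe).mp u
      have px : p ∣ x ^ 2 := by
        have : x ^ 2 = (x ^ 2 + 2 * (y + 2 * e1) ^ 2) - (y + 2 * e1) * (2 * (y + 2 * e1)) := by ring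
        rw [this]; exact v.sub ((py.add (pe.mul_left _)).mul_right _)
      exact bad p hp (sq_dvd' hp px) py (pe.mul_left _)
    obtain ⟨N, l, M, f, g1, g2, g3, -⟩ := stepB3a h1 (by ring) c1
    have l0 : l ≠ 0 := by rintro rfl; apply he; rw [g3]; ring
    have f0 : f ≠ 0 := by rintro rfl; apply he; rw [g3]; ring
    refine ⟨N, l, M, g1, g2, l0, ?_⟩
    have h2 : (3 * e1).natAbs = 3 * (l.natAbs * f.natAbs) := by
      rw [g3]; simp only [Int.natAbs_mul]; simp
    have h3 : 1 ≤ f.natAbs := Int.natAbs_pos.mpr f0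
    have h4 : 0 < l.natAbs := Int.natAbs_pos.mpr l0
    rw [h2]; nlinarith
  · have h1 : (3 * y - e) * ((3 * x) ^ 2 + 2 * (3 * y + 2 * e) ^ 2) = 19 * e ^ 3 := by linarith
    have c1 : IsCoprime (3 * y - e) ((3 * x) ^ 2 + 2 * (3 * y + 2 * e) ^ 2) := by
      apply cop_of_prime
      intro p hp u v
      have pe : p ∣ e := sq_dvd_19 hp (by rw [← h1]; exact mul_dvd_mul u v)
      have np3 : ¬ p ∣ 3 := fun hh => h3 ((prime_dvd_symm hp p3 hh).trans pe)
      have py' : p ∣ 3 * y := (dvd_sub_left pe).mp u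
      have px : p ∣ (3 * x) ^ 2 := by
        have : (3 * x) ^ 2 = ((3 * x) ^ 2 + 2 * (3 * y + 2 * e) ^ 2) -
          (3 * y + 2 * e) * (2 * (3 * y + 2 * e)) := by ring
        rw [this]; exact v.sub ((py'.add (pe.mul_left _)).mul_right _)
      exact bad p hp ((hp.dvd_or_dvd (sq_dvd' hp px)).resolve_left np3)
        ((hp.dvd_or_dvd py').resolve_left np3) pe
    obtain ⟨N, l, M, f, g1, g2, g3, g4⟩ := stepB3a h1 (by ring) c1
    have l0 : l ≠ 0 := by rintro rfl; apply he; rw [g3]; ring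
    have f0 : f ≠ 0 := by rintro rfl; apply he; rw [g3]; ring
    have f1 : 2 ≤ f := by
      have fn : 0 ≤ f := by
        have h5 : 0 ≤ f ^ 3 := by
          rcases g4 with g4 | g4 <;> nlinarith [sq_nonneg (3 * x), sq_nonneg (3 * y + 2 * e)]
        exact (Odd.pow_nonneg_iff (by decide : Odd 3)).mp h5
      have : f ≠ 1 := by
        rintro rfl
        generalize 3 * y + 2 * e = z at *
        have hx : x ^ 2 < 2 ^ 2 := by
          rcases g4 with g4 | g4 <;> nlinarith [sq_nonneg z, sq_nonneg x]
        have hz : z ^ 2 < 4 ^ 2 := by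
          rcases g4 with g4 | g4 <;> nlinarith [sq_nonneg z, sq_nonneg x]
        have hx' := abs_lt_of_sq_lt_sq' hx (by norm_num)
        have hz' := abs_lt_of_sq_lt_sq' hz (by norm_num)
        obtain ⟨x1, x2⟩ := hx'
        obtain ⟨z1, z2⟩ := hz'
        clear h h1 c1 bad hc
        interval_cases x <;> interval_cases z <;> norm_num at g4
      omega
    refine ⟨N, l, M, g1, g2, l0, ?_⟩
    have h2 : e.natAbs = l.natAbs * f.natAbs := by rw [g3, Int.natAbs_mul]
    have h3 : 2 ≤ f.natAbs := by omega
    have h4 : 0 < l.natAbs := Int.natAbs_pos.mpr l0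
    rw [h2]; nlinarith

theorem claimB (k : ℕ) : ∀ N E M : ℤ, E.natAbs = k →
    M ^ 2 + 2 * (3 * N * E + 19 * E ^ 3) ^ 2 = N ^ 3 → IsCoprime N E → E = 0 := by
  induction k using Nat.strong_induction_on with
  | _ k ih =>
    intro N E M hk h hc
    by_contra hE
    obtain ⟨n, e, m, h1, h2, h3, h4⟩ := stepB1 h hc hE
    obtain ⟨x, y, h5, h6⟩ := stepB2 h1 h2
    obtain ⟨N', l, M', h7, h8, h9, h10⟩ := stepB3 h5 h6 h3
    have : e.natAbs ≤ E.natAbs :=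
      Nat.le_of_dvd (Int.natAbs_pos.mpr hE) (Int.natAbs_dvd_natAbs.mpr h4)
    exact h9 (ih _ (by omega) N' l M' rfl h7 h8)

theorem ratB (x r : ℚ) (h : 6 * r ^ 2 = 4 * x ^ 3 + 4 * x ^ 2 - 36 * x - 59) : False := by
  obtain ⟨N, M, E, hE, hc, hx, hy⟩ := rat_form (6 * x + 8) (18 * r) 0 (-18) (-228) (-722)
    (by push_cast; linear_combination 54 * h)
  have hEQ : (E : ℚ) ≠ 0 := by exact_mod_cast hE
  have h1 : (18 * r) ^ 2 = (6 * x + 8) ^ 3 - 2 * (3 * (6 * x + 8) + 19) ^ 2 := by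
    linear_combination 54 * h
  rw [hx, hy] at h1
  field_simp at h1
  apply hE
  apply claimB _ N E M rfl _ hc
  have : (M : ℚ) ^ 2 + 2 * (3 * N * E + 19 * E ^ 3) ^ 2 = N ^ 3 := by linear_combination h1
  exact_mod_cast this

end X19
namespace X19

theorem curveK (z : ℝ) (hz : z ^ 2 = 6) (p q u v : ℚ)
    (h : ((u : ℝ) + v * z) ^ 2 + (u + v * z) =
      (p + q * z) ^ 3 + (p + q * z) ^ 2 - 9 * (p + q * z) - 15) :
    q = 0 ∧ v = 0 ∧ p = 5 ∧ (u = 9 ∨ u = -10) := by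
  have lin : ∀ s t : ℚ, (s : ℝ) + t * z = 0 → s = 0 ∧ t = 0 := by
    intro s t hst
    have ht : t = 0 := by
      by_contra ht
      have ht' : (t : ℝ) ≠ 0 := by exact_mod_cast ht
      apply no_sq_rat 6 (not_sq_int 6 2 (by norm_num) (by norm_num) (by norm_num)) (s / t)
      have : ((s / t : ℚ) : ℝ) ^ 2 = 6 := by
        have e : z = -(s / t : ℝ) := by field_simp; linarith
        rw [e] at hz; push_cast; linarith
      have h2 : (((s / t) ^ 2 : ℚ) : ℝ) = ((6 : ℚ) : ℝ) := by push_cast at this ⊢; exact this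
      exact_mod_cast h2
    refine ⟨?_, ht⟩
    rw [ht] at hst
    simpa using hst
  have e0 : ((u ^ 2 + 6 * v ^ 2 + u - (p ^ 3 + 18 * p * q ^ 2 + p ^ 2 + 6 * q ^ 2 - 9 * p - 15) : ℚ) : ℝ)
      + ((2 * u * v + v - (3 * p ^ 2 * q + 6 * q ^ 3 + 2 * p * q - 9 * q) : ℚ) : ℝ) * z = 0 := by
    push_cast
    linear_combination h + (3 * p * q ^ 2 + q ^ 3 * z + q ^ 2 - v ^ 2) * hz
  obtain ⟨e1, e2⟩ := lin _ _ e0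
  have hq : q = 0 := by
    by_contra hq
    refine ratB (6 * ((2 * u + 1) / (12 * q)) ^ 2 - 1 - 2 * p)
      (2 * v + 2 * ((2 * u + 1) / (12 * q)) *
        (6 * ((2 * u + 1) / (12 * q)) ^ 2 - 1 - 2 * p - p)) ?_
    obtain ⟨μ, hμ⟩ : ∃ μ, μ = (2 * u + 1) / (12 * q) := ⟨_, rfl⟩
    have hu : u = 6 * q * μ - 1 / 2 := by rw [hμ]; field_simp; ring
    rw [← hμ]
    subst hu
    have e3 : 12 * μ * v - (3 * p ^ 2 + 6 * q ^ 2 + 2 * p - 9) = 0 := by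
      apply mul_left_cancel₀ hq; linear_combination e2
    linear_combination 4 * e1 + 4 * (6 * μ ^ 2 - 1 - 3 * p) * e3
  subst hq
  have hv : v = 0 := by
    by_contra hv
    have h1 : (2 * u + 1) * v = 0 := by linarith
    have h2 := (mul_eq_zero.mp h1).resolve_right hv
    have h3 : u = -1 / 2 := by linarith
    subst h3
    exact ratB p (2 * v) (by linarith)
  subst hv
  obtain ⟨h5, h9⟩ := ratA p u (by linarith)
  exact ⟨rfl, rfl, h5, h9⟩

theorem memK (z : ℝ) (hz : z ^ 2 = 6) (w : ℚ⟮z⟯) : ∃ p q : ℚ, (w : ℝ) = p + q * z := by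
  obtain ⟨w, hw⟩ := w
  simp only
  induction hw using IntermediateField.adjoin_induction with
  | mem x hx => exact ⟨0, 1, by rw [Set.mem_singleton_iff.mp hx]; simp⟩
  | algebraMap x => exact ⟨x, 0, by simp⟩
  | add x y hx hy ihx ihy =>
    obtain ⟨p, q, rfl⟩ := ihx
    obtain ⟨r, s, rfl⟩ := ihy
    exact ⟨p + r, q + s, by push_cast; ring⟩
  | mul x y hx hy ihx ihy =>
    obtain ⟨p, q, rfl⟩ := ihx
    obtain ⟨r, s, rfl⟩ := ihy
    exact ⟨p * r + 6 * q * s, p * s + q * r, by push_cast; linear_combination q * s * hz⟩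
  | inv x hx ihx =>
    obtain ⟨p, q, rfl⟩ := ihx
    by_cases h0 : (p : ℝ) + q * z = 0
    · exact ⟨0, 0, by rw [h0]; simp⟩
    by_cases h1 : (p : ℝ) - q * z = 0
    · have hp : (p : ℝ) ≠ 0 := by
        intro hp
        rw [hp] at h0 h1
        exact h0 (by linarith)
      exact ⟨1 / (2 * p), 0, by
        have : (p : ℝ) + q * z = 2 * p := by linarith
        rw [this]; push_cast; simp⟩
    · have h2 : (p : ℝ) ^ 2 - 6 * q ^ 2 ≠ 0 := by
        have : (p : ℝ) ^ 2 - 6 * q ^ 2 = (p + q * z) * (p - q * z) := by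
          linear_combination (q : ℝ) ^ 2 * hz
        rw [this]; exact mul_ne_zero h0 h1
      refine ⟨p / (p ^ 2 - 6 * q ^ 2), -q / (p ^ 2 - 6 * q ^ 2), ?_⟩
      push_cast
      rw [inv_eq_iff_eq_inv, ← one_div, eq_div_iff]
      · have : ((p : ℝ) + q * z) * (p / (p ^ 2 - 6 * q ^ 2) + -q / (p ^ 2 - 6 * q ^ 2) * z) =
            ((p + q * z) * (p - q * z)) / (p ^ 2 - 6 * q ^ 2) := by ring
        rw [this, div_eq_iff h2]
        linear_combination -(q : ℝ) ^ 2 * hz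
      · intro h
        apply h1
        have : (p : ℝ) - q * z =
            (p / (p ^ 2 - 6 * q ^ 2) + -q / (p ^ 2 - 6 * q ^ 2) * z) * (p ^ 2 - 6 * q ^ 2) := by
          generalize (p : ℝ) ^ 2 - 6 * (q : ℝ) ^ 2 = D at h2
          field_simp
          try ring
        rw [this, h, zero_mul]

theorem ptsK (z : ℝ) (hz : z ^ 2 = 6) (x y : ℚ⟮z⟯) (h : (X0_19 ℚ⟮z⟯).Equation x y) :
    x = 5 ∧ (y = 9 ∨ y = -10) := by
  rw [WeierstrassCurve.Affine.equation_iff] at h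
  simp only [X0_19] at h
  obtain ⟨p, q, hx⟩ := memK z hz x
  obtain ⟨u, v, hy⟩ := memK z hz y
  have h' := congrArg (fun t : ℚ⟮z⟯ => (t : ℝ)) h
  have c5 : ((5 : ℚ⟮z⟯) : ℝ) = 5 := rfl
  have c9 : ((9 : ℚ⟮z⟯) : ℝ) = 9 := rfl
  have c10 : ((10 : ℚ⟮z⟯) : ℝ) = 10 := rfl
  have c15 : ((15 : ℚ⟮z⟯) : ℝ) = 15 := rfl
  push_cast at h'
  rw [hx, hy, c9, c15] at h'
  obtain ⟨rfl, rfl, rfl, h9⟩ := curveK z hz p q u v (by linarith)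
  refine ⟨Subtype.ext ?_, ?_⟩
  · rw [hx, c5]; push_cast; ring
  · rcases h9 with rfl | rfl
    · left; apply Subtype.ext; rw [hy, c9]; push_cast; ring
    · right; apply Subtype.ext; rw [hy]; push_cast; rw [c10]; ring

theorem ns (K : Type*) [Field K] [CharZero K] (y : K) (h : y = 9 ∨ y = -10) :
    (X0_19 K).Nonsingular 5 y := by
  rw [WeierstrassCurve.Affine.nonsingular_iff, WeierstrassCurve.Affine.equation_iff]
  have h19 : (19 : K) ≠ 0 := by norm_num
  rcases h with rfl | rfl
  · refine ⟨by simp only [X0_19]; norm_num, Or.inr ?_⟩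
    simp only [X0_19]; norm_num
  · refine ⟨by simp only [X0_19]; norm_num, Or.inr ?_⟩
    simp only [X0_19]; norm_num

end X19

/-- The group `X₀(19)(ℚ(√6))` is cyclic of order 3; in particular it coincides with the
group `X₀(19)(ℚ)` of rational points. -/
theorem X0_19_points_of_sqrt6 (z : ℝ) (hz : z ^ 2 = 6) :
    Nat.card (X0_19 ℚ⟮z⟯).Point = 3 ∧
    (∃ P : (X0_19 ℚ⟮z⟯).Point, ∀ Q : (X0_19 ℚ⟮z⟯).Point, Q ∈ AddSubgroup.zmultiples P) ∧
    PointsRational (X0_19 ℚ⟮z⟯) := by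
  have hcard : Nat.card (X0_19 ℚ⟮z⟯).Point = 3 := by
    let f : Fin 3 → (X0_19 ℚ⟮z⟯).Point :=
      ![.zero, .some 5 9 (X19.ns _ 9 (Or.inl rfl)), .some 5 (-10) (X19.ns _ (-10) (Or.inr rfl))]
    have hf : Function.Bijective f := by
      have hne : (9 : ℚ⟮z⟯) ≠ -10 := by norm_num
      constructor
      · intro i j hij
        fin_cases i <;> fin_cases j <;> simp [f] at hij ⊢
        · exact hne hij
        · exact hne hij.symm
      · rintro (_ | ⟨x, y, h⟩)
        · exact ⟨0, rfl⟩
        · obtain ⟨rfl, rfl | rfl⟩ := X19.ptsK z hz x y h.1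
          · exact ⟨1, rfl⟩
          · exact ⟨2, rfl⟩
    rw [← Nat.card_eq_of_bijective f hf]; simp
  refine ⟨hcard, ?_, ?_⟩
  · have : Fact (Nat.Prime 3) := ⟨by norm_num⟩
    have := isAddCyclic_of_prime_card hcard
    exact this.exists_generator
  · intro x y h
    obtain ⟨rfl, rfl | rfl⟩ := X19.ptsK z hz x y h.1
    · exact ⟨⟨5, by norm_num⟩, ⟨9, by norm_num⟩⟩
    · exact ⟨⟨5, by norm_num⟩, ⟨-10, by norm_num⟩⟩
end

section
/- For each d ∈ {2, 6, 7}, the group X₀(11)(Q(√d)) of Q(√d)-rational points of the modular curve X₀(11) contains a point of infinite order. -/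
open Polynomial IntermediateField NumberField

/-- The point has `x`-coordinate `a / b` with `a` odd, `b ≠ 0` and `2 ^ k ∣ b`. -/
def DeepPt {K : Type*} [Field K] (k : ℕ) (P : (X0_11 K).Point) : Prop :=
  ∃ (x y : K) (h : (X0_11 K).Nonsingular x y) (a b : ℤ), P = .some x y h ∧
    a % 2 = 1 ∧ b ≠ 0 ∧ (2 : ℤ) ^ k ∣ b ∧ x * b = a

lemma deepPt_double {K : Type*} [Field K] [CharZero K] [DecidableEq K] {k : ℕ}
    {P : (X0_11 K).Point} (hP : DeepPt (k + 1) P) : DeepPt (k + 2) (P + P) := by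
  obtain ⟨x, y, h, a, b, rfl, ha, hb, hk, hx⟩ := hP
  have heq : y ^ 2 + y = x ^ 3 - x ^ 2 - 10 * x - 20 := by
    have := (WeierstrassCurve.Affine.equation_iff _ _).1 h.1
    simp only [X0_11] at this
    linear_combination this
  have hbK : (b : K) ≠ 0 := by exact_mod_cast hb
  obtain ⟨c, hc⟩ : (2 : ℤ) ∣ b := (dvd_pow_self 2 (by omega)).trans hk
  obtain ⟨e, he⟩ : ∃ e, a = 2 * e + 1 := ⟨a / 2, by omega⟩
  set D : ℤ := 4 * a ^ 3 - 4 * a ^ 2 * b - 40 * a * b ^ 2 - 79 * b ^ 3 with hD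
  have hD2 : (2 : ℤ) ∣ D := by
    refine ⟨2 * a ^ 3 - 2 * a ^ 2 * b - 20 * a * b ^ 2 - 79 * c * b ^ 2, ?_⟩
    rw [hD]
    linear_combination (-79 * b ^ 2) * hc
  have hD0 : D ≠ 0 := by
    intro h0
    have : 4 = 8 * (-(4 * e ^ 3 + 6 * e ^ 2 + 3 * e - a ^ 2 * c - 20 * a * c ^ 2 - 79 * c ^ 3)) := by
      rw [hD, hc] at h0
      rw [he] at h0 ⊢
      linear_combination h0
    omega
  have hDK : (D : K) ≠ 0 := by exact_mod_cast hD0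
  have hF : (2 * y + 1) ^ 2 * (b : K) ^ 3 = D := by
    rw [hD]
    push_cast
    rw [← hx]
    linear_combination 4 * (b : K) ^ 3 * heq
  have hy0 : 2 * y + 1 ≠ 0 := by
    intro h0
    apply hDK
    rw [← hF, h0]
    ring
  have hy : y ≠ (X0_11 K).negY x y := by
    intro h0
    apply hy0
    simp only [X0_11, WeierstrassCurve.Affine.negY] at h0
    linear_combination h0
  rw [WeierstrassCurve.Affine.Point.add_self_of_Y_ne hy]
  refine ⟨_, _, _, a ^ 4 + 20 * a ^ 2 * b ^ 2 + 158 * a * b ^ 3 + 21 * b ^ 4, b * D, rfl,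
    ?_, mul_ne_zero hb hD0, ?_, ?_⟩
  · have h2 : (a ^ 4 + 20 * a ^ 2 * b ^ 2 + 158 * a * b ^ 3 + 21 * b ^ 4) =
      2 * (8 * e ^ 4 + 16 * e ^ 3 + 12 * e ^ 2 + 4 * e
        + 10 * a ^ 2 * b ^ 2 + 79 * a * b ^ 3 + 21 * c * b ^ 3) + 1 := by
      have h4 : a ^ 4 = 2 * (8 * e ^ 4 + 16 * e ^ 3 + 12 * e ^ 2 + 4 * e) + 1 := by
        rw [he]; ring
      linear_combination h4 + 21 * b ^ 3 * hc
    omega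
  · rw [pow_succ]
    exact mul_dvd_mul hk hD2
  · rw [WeierstrassCurve.Affine.slope_of_Y_ne rfl hy]
    simp only [X0_11, WeierstrassCurve.Affine.negY, WeierstrassCurve.Affine.addX]
    have e1 : y - (-y - 0 * x - 1) = 2 * y + 1 := by ring
    rw [e1]
    push_cast
    rw [← hF, ← hx]
    field_simp
    linear_combination (1 - 2 * x) * 4 * heq

lemma deepPt_pow {K : Type*} [Field K] [CharZero K] [DecidableEq K]
    {P : (X0_11 K).Point} (hP : DeepPt 1 P) (k : ℕ) : DeepPt (k + 1) (2 ^ k • P) := by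
  induction k with
  | zero => simpa using hP
  | succ k ih =>
    have := deepPt_double ih
    rwa [← two_nsmul, ← mul_nsmul', ← pow_succ'] at this

lemma deepPt_infinite {K : Type*} [Field K] [CharZero K] [DecidableEq K]
    {P : (X0_11 K).Point} (hP : DeepPt 1 P) (n : ℕ) (hn : 0 < n) : n • P ≠ 0 := by
  intro h0
  obtain ⟨k, m, hm, rfl⟩ := Nat.exists_eq_two_pow_mul_odd hn.ne'
  have hco : Nat.Coprime 2 m := (Nat.coprime_two_left).2 hm
  have hmpos : 0 < m := hm.pos
  -- the points `2 ^ (k + φ(m) t) • P` all agree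
  have key : ∀ t : ℕ, 2 ^ (k + m.totient * t) • P = 2 ^ k • P := by
    intro t
    have h1 : 1 ≡ 2 ^ (m.totient * t) [MOD m] := by
      have := (Nat.ModEq.pow_totient hco).pow t
      rw [one_pow, ← pow_mul] at this
      exact this.symm
    obtain ⟨s, hs⟩ := (Nat.modEq_iff_dvd' Nat.one_le_two_pow).1 h1
    have h2 : 2 ^ (m.totient * t) = m * s + 1 := by
      have : 1 ≤ 2 ^ (m.totient * t) := Nat.one_le_two_pow
      omega
    have h3 : 2 ^ (k + m.totient * t) = s * (2 ^ k * m) + 2 ^ k := by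
      rw [pow_add, h2]; ring
    rw [h3, add_nsmul, mul_nsmul', h0, nsmul_zero, zero_add]
  obtain ⟨x, y, h, a, b, hQ, ha, hb, -, hx⟩ := deepPt_pow hP k
  have hall := deepPt_pow hP (k + m.totient * b.natAbs)
  rw [key] at hall
  obtain ⟨x', y', h', a', b', hQ', ha', hb', hk', hx'⟩ := hall
  have hxx : x = x' := by
    rw [hQ] at hQ'
    exact (WeierstrassCurve.Affine.Point.some.inj hQ').1
  subst hxx
  have hcross : a * b' = a' * b := by
    have : (a : K) * b' = a' * b := by rw [← hx, ← hx']; ring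
    exact_mod_cast this
  have hdvd : (2 : ℤ) ^ (k + m.totient * b.natAbs + 1) ∣ b := by
    have h1 : (2 : ℤ) ^ (k + m.totient * b.natAbs + 1) ∣ a' * b := by
      rw [← hcross]; exact hk'.mul_left a
    refine IsCoprime.dvd_of_dvd_mul_left (IsCoprime.pow_left ?_) h1
    exact ⟨-(a' / 2), 1, by omega⟩
  have h2 : 2 ^ (k + m.totient * b.natAbs + 1) ≤ b.natAbs := by
    have := Int.natAbs_dvd_natAbs.2 hdvd
    rw [Int.natAbs_pow] at this
    exact Nat.le_of_dvd (Int.natAbs_pos.2 hb) this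
  have h3 : b.natAbs ≤ k + m.totient * b.natAbs + 1 := by
    have := Nat.totient_pos.2 hmpos
    have := Nat.le_mul_of_pos_left b.natAbs this
    omega
  have h4 := Nat.lt_two_pow_self (n := k + m.totient * b.natAbs + 1)
  omega

lemma exists_of_xy {K : Type*} [Field K] [CharZero K] [DecidableEq K] (x y : K) (a b : ℤ)
    (ha : a % 2 = 1) (hb : b ≠ 0) (hb2 : (2 : ℤ) ∣ b) (hx : x * b = a)
    (heq : y ^ 2 + y = x ^ 3 - x ^ 2 - 10 * x - 20) (hy : 2 * y + 1 ≠ 0) :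
    ∃ P : (X0_11 K).Point, ∀ n : ℕ, 0 < n → n • P ≠ 0 := by
  have hns : (X0_11 K).Nonsingular x y := by
    rw [WeierstrassCurve.Affine.nonsingular_iff, WeierstrassCurve.Affine.equation_iff]
    simp only [X0_11]
    refine ⟨by linear_combination heq, Or.inr ?_⟩
    intro h0
    apply hy
    linear_combination h0
  exact ⟨.some x y hns, deepPt_infinite ⟨x, y, hns, a, b, rfl, ha, hb, by simpa using hb2, hx⟩⟩

/-- For each `d ∈ {2, 6, 7}`, the group `X₀(11)(ℚ(√d))` contains a point of infinite order. -/
theorem X0_11_infinite_order_point (d : ℕ) (hd : d ∈ ({2, 6, 7} : Set ℕ))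
    (z : ℝ) (hz : z ^ 2 = d) :
    ∃ P : (X0_11 ℚ⟮z⟯).Point, ∀ n : ℕ, 0 < n → n • P ≠ 0 := by
  obtain ⟨w, hw⟩ : ∃ w : ℚ⟮z⟯, w ^ 2 = (d : ℚ⟮z⟯) :=
    ⟨⟨z, mem_adjoin_simple_self ℚ z⟩, Subtype.ext (by push_cast; exact hz)⟩
  have hw0 : (d : ℚ⟮z⟯) ≠ 0 → w ≠ 0 := by
    rintro h rfl
    apply h
    rw [← hw]
    ring
  rcases hd with rfl | rfl | rfl
  · have hw1 := hw0 (by norm_num)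
    push_cast at hw
    refine exists_of_xy (9 / 2) ((7 / 2 * w - 1) / 2) 9 2 (by norm_num) (by norm_num)
      (by norm_num) (by norm_num) (by linear_combination (49 / 16) * hw) ?_
    intro h0
    apply hw1
    linear_combination (2 / 7) * h0
  · have hw1 := hw0 (by norm_num)
    push_cast at hw
    refine exists_of_xy (5281 / 150) ((22597260 / 135000 * w - 1) / 2) 5281 150 (by norm_num)
      (by norm_num) (by norm_num) (by norm_num)
      (by linear_combination ((22597260 / 135000) ^ 2 / 4) * hw) ?_
    intro h0
    apply hw1
    linear_combination (135000 / 22597260) * h0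
  · have hw1 := hw0 (by norm_num)
    push_cast at hw
    refine exists_of_xy (379 / 36) ((209244 / 9072 * w - 1) / 2) 379 36 (by norm_num)
      (by norm_num) (by norm_num) (by norm_num)
      (by linear_combination ((209244 / 9072) ^ 2 / 4) * hw) ?_
    intro h0
    apply hw1
    linear_combination (9072 / 209244) * h0
end
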